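/- arXiv:1903.12315 — 2 statements merged into one kernel-verified Lean document; each statement's English description precedes it below -/
import Mathlib

section
/- Let α ∈ (0,1], δ ∈ (-1,1) (with δ = 0 if α = 1), and let p_t be the density of the α-stable law with characteristic function λ ↦ exp(−t|λ|^α(1 − iδ sign(λ) tan(πα/2))) (exp(−t|λ|) when α = 1). Then there is a constant C_α > 0 such that for all t > 0 and all x, y ∈ ℝ, |p_t(x) − p_t(y)| ≤ C_α ( (|x − y| / t^{1/α}) ∧ 1 ) (p_t(x) + p_t(y)). -/
open MeasureTheory Real Filter Set
open scoped Topology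

noncomputable section

/-- Normalizing constant `d_α`. -/
def dconst (α : ℝ) : ℝ :=
  if α = 1 then 2 / π else -1 / (Real.Gamma (-α) * Real.cos (π * α / 2))

/-- Density of the Lévy measure `ν_{α,δ}` with respect to Lebesgue measure. -/
def nuDens (α δ : ℝ) (u : ℝ) : ℝ :=
  dconst α * (if 0 < u then (1 + δ) / 2 * u ^ (-1 - α)
    else if u < 0 then (1 - δ) / 2 * |u| ^ (-1 - α) else 0)

/-- Generator `L^{α,δ}` for `α ∈ (0,1)`. -/
def Lop (α δ : ℝ) (f : ℝ → ℝ) (x : ℝ) : ℝ :=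
  ∫ u, (f (x + u) - f x) * nuDens α δ u

/-- Generator `L^{1,0}` (note `ν_{1,0}(du) = (2/π)|u|⁻²/2 du = 1/(π u²) du`). -/
def Lop1 (f : ℝ → ℝ) (x : ℝ) : ℝ :=
  ∫ u, (f (x + u) - f x - (if |u| ≤ 1 then u * deriv f x else 0)) * (1 / (π * u ^ 2))

/-- Combined generator. -/
def LopA (α δ : ℝ) (f : ℝ → ℝ) (x : ℝ) : ℝ :=
  if α = 1 then Lop1 f x else Lop α δ f x

/-- Characteristic function of the strictly `α`-stable law at time `t`. -/
def stableCF (α δ t l : ℝ) : ℂ :=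
  if α = 1 then Complex.exp (↑(-(t * |l|)) : ℂ)
  else Complex.exp ((↑(-(t * |l| ^ α)) : ℂ) *
    (1 - Complex.I * (δ : ℂ) * ((Real.sign l : ℝ) : ℂ) * ((Real.tan (π * α / 2) : ℝ) : ℂ)))

/-- `μ` is the strictly `α`-stable law `S_α(δ)`. -/
def IsStableLaw (α δ : ℝ) (μ : Measure ℝ) : Prop :=
  ∀ l : ℝ, (∫ x, Complex.exp (Complex.I * (l : ℂ) * (x : ℂ)) ∂μ) = stableCF α δ 1 l

/-- The class `H_β`. -/
def memHbeta (β : ℝ) (h : ℝ → ℝ) : Prop :=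
  ∀ x y : ℝ, |h x - h y| ≤ min |x - y| (|x - y| ^ β)

/-- The distance `d_{W_β}`. -/
def dWbeta (β : ℝ) (μ ν : Measure ℝ) : ℝ :=
  sSup { r | ∃ h : ℝ → ℝ, memHbeta β h ∧ r = |(∫ x, h x ∂μ) - ∫ x, h x ∂ν| }

/-- The Kolmogorov distance. -/
def dKol (μ ν : Measure ℝ) : ℝ :=
  sSup { r | ∃ x : ℝ, r = |(μ (Set.Iic x)).toReal - (ν (Set.Iic x)).toReal| }

/-- The solution of Stein's equation. -/
def steinSol (α : ℝ) (p h : ℝ → ℝ) (x : ℝ) : ℝ :=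
  -∫ t in Set.Ioi (0:ℝ), ∫ y, p y *
    (h ((1 - Real.exp (-t)) ^ (1/α) * y + Real.exp (-t/α) * x) - h y)

theorem aux_intOn {a q : ℝ} (ha : 0 < a) (hq : -1 < q) {b : ℝ} (hb : 0 < b) :
    IntegrableOn (fun u : ℝ => u ^ q * rexp (-b * u ^ a)) (Ioi 0) := by
  by_contra h
  have h2 := integral_rpow_mul_exp_neg_mul_rpow ha hq hb
  rw [integral_undef h] at h2
  have : 0 < b ^ (-(q + 1) / a) * (1 / a) * Real.Gamma ((q + 1) / a) := by
    have : 0 < Real.Gamma ((q + 1) / a) := Real.Gamma_pos_of_pos (div_pos (by linarith) ha)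
    positivity
  linarith

theorem aux_rpow_le {a u : ℝ} (ha0 : 0 < a) (ha1 : a ≤ 1) (hu : 0 ≤ u) : u ^ a ≤ 1 + u := by
  rcases le_total u 1 with h | h
  · have := Real.rpow_le_one hu h ha0.le
    linarith
  · have := Real.rpow_le_rpow_of_exponent_le h ha1
    rw [Real.rpow_one] at this
    linarith

/-- The exponent on the rotated ray. -/
def rotE (a τ x θ u : ℝ) : ℂ :=
  -(Complex.I * θ) - Complex.I * x * u * Complex.exp (-(Complex.I * θ))
    - (1 - Complex.I * τ) * ((u ^ a : ℝ) : ℂ) * Complex.exp (-(Complex.I * (a * θ)))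

theorem rotE_re (a τ x θ u : ℝ) : (rotE a τ x θ u).re =
    -(x * u * sin θ) - u ^ a * (cos (a * θ) - τ * sin (a * θ)) := by
  have e1 : Complex.exp (-(Complex.I * θ)) = cos θ - Complex.I * sin θ := by
    rw [show -(Complex.I * (θ : ℂ)) = ((-θ : ℝ) : ℂ) * Complex.I by push_cast; ring,
      Complex.exp_mul_I]
    push_cast; rw [Complex.cos_neg, Complex.sin_neg]; ring
  have e2 : Complex.exp (-(Complex.I * (a * θ))) = cos (a * θ) - Complex.I * sin (a * θ) := by
    rw [show -(Complex.I * (a * (θ : ℂ))) = ((-(a * θ) : ℝ) : ℂ) * Complex.I by push_cast; ring,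
      Complex.exp_mul_I]
    push_cast; rw [Complex.cos_neg, Complex.sin_neg]; ring
  rw [rotE, e1, e2]
  simp only [Complex.sub_re, Complex.sub_im, Complex.mul_re, Complex.mul_im, Complex.neg_re,
    Complex.I_re, Complex.I_im, Complex.ofReal_re, Complex.ofReal_im, Complex.one_re,
    Complex.one_im]
  ring

theorem rotE_bound {a τ x θ u : ℝ} (ha0 : 0 < a) (ha1 : a ≤ 1) (hx : π * (|τ| + 1) / 2 ≤ x)
    (h0 : 0 ≤ θ) (h1 : θ ≤ π / 2) (hu : 0 ≤ u) :
    (rotE a τ x θ u).re ≤ (|τ| + 1) * π / 2 - u ^ a := by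
  rw [rotE_re]
  have hs := aux_rpow_le ha0 ha1 hu
  have hs0 : 0 ≤ u ^ a := Real.rpow_nonneg hu a
  set s := u ^ a
  have hpi := Real.pi_pos
  have hpi3 := Real.pi_gt_three
  have haθ0 : 0 ≤ a * θ := by positivity
  have haθ : a * θ ≤ θ := by nlinarith
  have hsin1 := Real.mul_le_sin h0 h1
  have hsin2 : sin (a * θ) ≤ θ := (Real.sin_le haθ0).trans haθ
  have hsin3 : 0 ≤ sin (a * θ) := Real.sin_nonneg_of_nonneg_of_le_pi haθ0 (by linarith)
  have hcos : cos θ ≤ cos (a * θ) :=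
    Real.cos_le_cos_of_nonneg_of_le_pi haθ0 (by linarith) haθ
  have hcos1 := Real.one_sub_mul_le_cos h0 h1
  have t0 := abs_nonneg τ
  have A : (|τ| + 1) * θ * u ≤ x * u * sin θ := by
    have : (|τ| + 1) * θ ≤ x * sin θ := by
      calc (|τ| + 1) * θ = (π * (|τ| + 1) / 2) * (2 / π * θ) := by field_simp
        _ ≤ x * sin θ := by
          apply mul_le_mul hx hsin1 (by positivity)
          exact le_trans (by positivity) hx
    nlinarith
  have B : s * (τ * sin (a * θ)) ≤ s * (|τ| * θ) := by
    apply mul_le_mul_of_nonneg_left _ hs0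
    calc τ * sin (a * θ) ≤ |τ| * sin (a * θ) := mul_le_mul_of_nonneg_right (le_abs_self _) hsin3
      _ ≤ |τ| * θ := mul_le_mul_of_nonneg_left hsin2 t0
  have C : s * (1 - 2 / π * θ) ≤ s * cos (a * θ) :=
    mul_le_mul_of_nonneg_left (hcos1.trans hcos) hs0
  have D : (|τ| + 1) * θ * s ≤ (|τ| + 1) * θ * (1 + u) :=
    mul_le_mul_of_nonneg_left hs (by positivity)
  have E : (|τ| + 1) * θ ≤ (|τ| + 1) * (π / 2) := mul_le_mul_of_nonneg_left h1 (by positivity)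
  have F : s * (2 / π * θ) ≤ s * θ := by
    apply mul_le_mul_of_nonneg_left _ hs0
    have : 2 / π ≤ 1 := by rw [div_le_one hpi]; linarith
    nlinarith
  nlinarith

theorem rotE_cont (a τ x θ : ℝ) (ha0 : 0 < a) : Continuous (rotE a τ x θ) := by
  unfold rotE
  have : Continuous (fun u : ℝ => u ^ a) := Real.continuous_rpow_const ha0.le
  fun_prop

theorem rotE_contθ (a τ x u : ℝ) : Continuous (fun θ => rotE a τ x θ u) := by
  unfold rotE
  fun_prop

def rotK (a τ x θ u : ℝ) : ℂ := 1 - Complex.I * x * u * Complex.exp (-(Complex.I * θ))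
    - a * (1 - Complex.I * τ) * ((u ^ a : ℝ) : ℂ) * Complex.exp (-(Complex.I * (a * θ)))

theorem rotE_derivθ (a τ x θ u : ℝ) :
    HasDerivAt (fun θ => Complex.exp (rotE a τ x θ u))
      (-Complex.I * (Complex.exp (rotE a τ x θ u) * rotK a τ x θ u)) θ := by
  have h0 : HasDerivAt (fun θ : ℝ => (θ : ℂ)) 1 θ := by
    simpa using (hasDerivAt_id θ).ofReal_comp
  have h1 := (h0.const_mul Complex.I).neg
  have h2 := ((h0.const_mul (a : ℂ)).const_mul Complex.I).neg
  have h := ((h1.sub (h1.cexp.const_mul (Complex.I * x * u))).sub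
    (h2.cexp.const_mul ((1 - Complex.I * τ) * ((u ^ a : ℝ) : ℂ)))).cexp
  refine HasDerivAt.congr_deriv (f := fun θ : ℝ => Complex.exp (rotE a τ x θ u)) h ?_
  simp only [Pi.neg_apply, Pi.sub_apply]
  rw [← rotE, rotK]
  ring

theorem rotE_derivu (a τ x θ u : ℝ) (hu : 0 < u) :
    HasDerivAt (fun u : ℝ => (u : ℂ) * Complex.exp (rotE a τ x θ u))
      (Complex.exp (rotE a τ x θ u) * rotK a τ x θ u) u := by
  have h0 : HasDerivAt (fun θ : ℝ => (θ : ℂ)) 1 u := by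
    simpa using (hasDerivAt_id u).ofReal_comp
  have h1 : HasDerivAt (fun u : ℝ => ((u ^ a : ℝ) : ℂ)) ((a * u ^ (a - 1) : ℝ) : ℂ) u :=
    (Real.hasDerivAt_rpow_const (Or.inl hu.ne')).ofReal_comp
  have hu1 : u * u ^ (a - 1) = u ^ a := by
    rw [mul_comm, ← Real.rpow_add_one hu.ne']; ring_nf
  have hu2 : (u : ℂ) * ((u ^ (a - 1) : ℝ) : ℂ) = ((u ^ a : ℝ) : ℂ) := by
    rw [← hu1]; push_cast; ring
  have h := h0.mul ((((h0.const_mul (Complex.I * x)).mul_const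
      (Complex.exp (-(Complex.I * θ)))).const_sub (-(Complex.I * θ))).sub
    ((h1.const_mul (1 - Complex.I * τ)).mul_const (Complex.exp (-(Complex.I * (a * θ)))))).cexp
  refine HasDerivAt.congr_deriv
    (f := fun u : ℝ => (u : ℂ) * Complex.exp (rotE a τ x θ u)) h ?_
  simp only [Pi.neg_apply, Pi.sub_apply]
  rw [← rotE, rotK, ← hu2]
  push_cast
  ring

def rotB (a τ x u : ℝ) : ℝ := rexp ((|τ| + 1) * π / 2) * (rexp (-1 * u ^ a) * (1 + |x| * u +
    a * ‖(1 - Complex.I * τ : ℂ)‖ * u ^ a))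

theorem rotB_int (a τ x : ℝ) (ha : 0 < a) : IntegrableOn (rotB a τ x) (Ioi 0) := by
  have h0 := aux_intOn (q := 0) ha (by norm_num) one_pos
  have h1 := aux_intOn (q := 1) ha (by norm_num) one_pos
  have h2 := aux_intOn (q := a) ha (by linarith) one_pos
  have := ((h0.add (h1.const_mul |x|)).add
    (h2.const_mul (a * ‖(1 - Complex.I * τ : ℂ)‖))).const_mul (rexp ((|τ| + 1) * π / 2))
  refine Integrable.congr this (Eventually.of_forall fun u => ?_)
  simp only [Pi.add_apply, rotB, Real.rpow_zero, Real.rpow_one]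
  ring

theorem rot_norm_le {a τ x θ u : ℝ} (ha0 : 0 < a) (ha1 : a ≤ 1) (hx : π * (|τ| + 1) / 2 ≤ x)
    (h0 : 0 ≤ θ) (h1 : θ ≤ π / 2) (hu : 0 ≤ u) :
    ‖Complex.exp (rotE a τ x θ u)‖ ≤ rexp ((|τ| + 1) * π / 2) * rexp (-1 * u ^ a) := by
  rw [Complex.norm_exp, ← Real.exp_add]
  apply Real.exp_le_exp.2
  have := rotE_bound ha0 ha1 hx h0 h1 hu
  linarith

theorem rotK_norm_le {a τ x θ u : ℝ} (ha0 : 0 < a) (hu : 0 ≤ u) :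
    ‖rotK a τ x θ u‖ ≤ 1 + |x| * u + a * ‖(1 - Complex.I * τ : ℂ)‖ * u ^ a := by
  have e1 : ‖Complex.exp (-(Complex.I * θ))‖ = 1 := by
    rw [Complex.norm_exp]; simp
  have e2 : ‖Complex.exp (-(Complex.I * (a * θ)))‖ = 1 := by
    rw [Complex.norm_exp]; simp
  unfold rotK
  refine (norm_sub_le _ _).trans (add_le_add ((norm_sub_le _ _).trans (add_le_add ?_ ?_)) ?_)
  · simp
  · rw [norm_mul, norm_mul, norm_mul, e1]; simp [abs_of_nonneg hu]
  · rw [norm_mul, norm_mul, norm_mul, e2]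
    simp [abs_of_nonneg (Real.rpow_nonneg hu a), abs_of_pos ha0]

theorem rot_const {a τ x : ℝ} (ha0 : 0 < a) (ha1 : a ≤ 1) (hx : π * (|τ| + 1) / 2 ≤ x) :
    (∫ u in Ioi (0:ℝ), Complex.exp (rotE a τ x 0 u)).re =
      (∫ u in Ioi (0:ℝ), Complex.exp (rotE a τ x (π / 2) u)).re := by
  have hpi := Real.pi_pos
  have hmeas : ∀ θ, AEStronglyMeasurable (fun u => Complex.exp (rotE a τ x θ u))
      (volume.restrict (Ioi 0)) := fun θ =>
    (Complex.continuous_exp.comp (rotE_cont a τ x θ ha0)).aestronglyMeasurable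
  have hb0 : IntegrableOn (fun u : ℝ => rexp ((|τ| + 1) * π / 2) * rexp (-1 * u ^ a)) (Ioi 0) := by
    have h0 := aux_intOn (q := 0) ha0 (by norm_num) one_pos
    simpa [IntegrableOn] using h0.const_mul (rexp ((|τ| + 1) * π / 2))
  have hcont : ContinuousOn (fun θ => ∫ u in Ioi (0:ℝ), Complex.exp (rotE a τ x θ u))
      (Icc 0 (π / 2)) := by
    apply continuousOn_of_dominated (fun θ _ => hmeas θ) _ hb0
    · refine Eventually.of_forall fun u => ?_
      exact (Complex.continuous_exp.comp (rotE_contθ a τ x u)).continuousOn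
    · intro θ hθ
      refine (ae_restrict_iff' measurableSet_Ioi).2 (Eventually.of_forall fun u hu => ?_)
      exact rot_norm_le ha0 ha1 hx hθ.1 hθ.2 (le_of_lt hu)
  have hder : ∀ θ ∈ Ioo 0 (π / 2),
      HasDerivAt (fun θ => ∫ u in Ioi (0:ℝ), Complex.exp (rotE a τ x θ u)) 0 θ := by
    intro θ hθ
    have hcK : Continuous (fun u => Complex.exp (rotE a τ x θ u) * rotK a τ x θ u) := by
      refine (Complex.continuous_exp.comp (rotE_cont a τ x θ ha0)).mul ?_
      unfold rotK
      have : Continuous (fun u : ℝ => u ^ a) := Real.continuous_rpow_const ha0.le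
      fun_prop
    have key := hasDerivAt_integral_of_dominated_loc_of_deriv_le
      (μ := volume.restrict (Ioi (0:ℝ))) (s := Ioo 0 (π / 2)) (x₀ := θ)
      (F := fun θ u => Complex.exp (rotE a τ x θ u))
      (F' := fun θ u => -Complex.I * (Complex.exp (rotE a τ x θ u) * rotK a τ x θ u))
      (bound := rotB a τ x) (Ioo_mem_nhds hθ.1 hθ.2) (Eventually.of_forall hmeas)
      (by
        refine hb0.mono' (hmeas θ) ?_
        refine (ae_restrict_iff' measurableSet_Ioi).2 (Eventually.of_forall fun u hu => ?_)
        exact rot_norm_le ha0 ha1 hx hθ.1.le hθ.2.le (le_of_lt hu))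
      (by exact (continuous_const.mul hcK).aestronglyMeasurable)
      (by
        refine (ae_restrict_iff' measurableSet_Ioi).2 (Eventually.of_forall fun u hu => ?_)
        intro θ hθ
        have hu' : 0 ≤ u := le_of_lt hu
        rw [norm_mul, norm_mul, norm_neg, Complex.norm_I, one_mul, rotB, ← mul_assoc]
        exact mul_le_mul (rot_norm_le ha0 ha1 hx hθ.1.le hθ.2.le hu')
          (rotK_norm_le ha0 hu') (norm_nonneg _) (by positivity))
      (rotB_int a τ x ha0)
      (Eventually.of_forall fun u θ _ => rotE_derivθ a τ x θ u)
    have hz : ∫ u in Ioi (0:ℝ), Complex.exp (rotE a τ x θ u) * rotK a τ x θ u = 0 := by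
      have hint : IntegrableOn (fun u => Complex.exp (rotE a τ x θ u) * rotK a τ x θ u)
          (Ioi 0) := by
        have := key.1.const_mul Complex.I
        refine this.congr (Eventually.of_forall fun u => ?_)
        simp only []
        rw [← mul_assoc]; simp
      have := integral_Ioi_of_hasDerivAt_of_tendsto (a := 0) (m := 0)
        (f := fun u : ℝ => (u : ℂ) * Complex.exp (rotE a τ x θ u)) 
        (by
          refine Continuous.continuousWithinAt ?_
          exact Complex.continuous_ofReal.mul
            (Complex.continuous_exp.comp (rotE_cont a τ x θ ha0)))
        (fun u hu => rotE_derivu a τ x θ u hu) hint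
        (by
          have h1 : Tendsto (fun u : ℝ => rexp ((|τ| + 1) * π / 2) *
              ((u ^ a) ^ (1 / a) * rexp (-1 * u ^ a))) atTop (𝓝 0) := by
            rw [← mul_zero (rexp ((|τ| + 1) * π / 2))]
            apply Tendsto.const_mul
            exact (tendsto_rpow_mul_exp_neg_mul_atTop_nhds_zero (1 / a) 1 one_pos).comp
              (tendsto_rpow_atTop ha0)
          refine squeeze_zero_norm' ?_ h1
          filter_upwards [eventually_ge_atTop 0] with u hu
          rw [norm_mul, ← Real.rpow_mul hu, mul_one_div_cancel ha0.ne', Real.rpow_one]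
          have := rot_norm_le ha0 ha1 hx hθ.1.le hθ.2.le hu
          rw [Complex.norm_real, Real.norm_of_nonneg hu]
          calc _ ≤ u * (rexp ((|τ| + 1) * π / 2) * rexp (-1 * u ^ a)) :=
              mul_le_mul_of_nonneg_left this hu
            _ = _ := by ring)
      simpa using this
    have h2 := key.2
    rw [integral_const_mul, hz, mul_zero] at h2
    exact h2
  obtain ⟨c, hc, hc2⟩ := exists_hasDerivAt_eq_slope
    (fun θ => (∫ u in Ioi (0:ℝ), Complex.exp (rotE a τ x θ u)).re) (fun _ => 0)
    (show (0:ℝ) < π / 2 by positivity) (Complex.continuous_re.comp_continuousOn hcont)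
    (fun θ hθ => by
      have := Complex.reCLM.hasFDerivAt.comp_hasDerivAt θ (hder θ hθ)
      rw [map_zero] at this
      exact this)
  have : (π / 2 - 0) ≠ 0 := by linarith
  rw [eq_comm, div_eq_zero_iff] at hc2
  rcases hc2 with h | h
  · linarith
  · exact absurd h this

/-- Real inversion integral. -/
def GG (a τ x : ℝ) : ℝ := ∫ l in Ioi (0:ℝ), rexp (-1 * l ^ a) * cos (x * l - τ * l ^ a)

theorem rot_int {a τ x θ : ℝ} (ha0 : 0 < a) (ha1 : a ≤ 1) (hx : π * (|τ| + 1) / 2 ≤ x)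
    (h0 : 0 ≤ θ) (h1 : θ ≤ π / 2) :
    IntegrableOn (fun u => Complex.exp (rotE a τ x θ u)) (Ioi 0) := by
  have hb0 : IntegrableOn (fun u : ℝ => rexp ((|τ| + 1) * π / 2) * rexp (-1 * u ^ a)) (Ioi 0) := by
    have h0 := aux_intOn (q := 0) ha0 (by norm_num) one_pos
    simpa [IntegrableOn] using h0.const_mul (rexp ((|τ| + 1) * π / 2))
  refine hb0.mono' (Complex.continuous_exp.comp (rotE_cont a τ x θ ha0)).aestronglyMeasurable ?_
  refine (ae_restrict_iff' measurableSet_Ioi).2 (Eventually.of_forall fun u hu => ?_)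
  exact rot_norm_le ha0 ha1 hx h0 h1 (le_of_lt hu)

theorem GG_rot {a τ x : ℝ} (ha0 : 0 < a) (ha1 : a ≤ 1) (hx : π * (|τ| + 1) / 2 ≤ x) :
    GG a τ x = ∫ u in Ioi (0:ℝ), rexp (-x * u) *
      (rexp (-(cos (π * a / 2) - τ * sin (π * a / 2)) * u ^ a) *
        sin ((sin (π * a / 2) + τ * cos (π * a / 2)) * u ^ a)) := by
  have hpi := Real.pi_pos
  have h := rot_const (τ := τ) (x := x) ha0 ha1 hx
  have r := fun θ h0 h1 => integral_re (𝕜 := ℂ) (rot_int (τ := τ) (x := x) (θ := θ) ha0 ha1 hx h0 h1)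
  have r0 := r 0 le_rfl (by positivity)
  have r1 := r (π / 2) (by positivity) le_rfl
  simp only [RCLike.re_to_complex] at r0 r1
  rw [← r0, ← r1] at h
  rw [GG]
  convert h using 1
  · refine setIntegral_congr_fun measurableSet_Ioi fun u _ => ?_
    have : rotE a τ x 0 u = ((-1 * u ^ a : ℝ) : ℂ) + ((-(x * u - τ * u ^ a) : ℝ) : ℂ) * Complex.I := by
      simp [rotE]; ring
    simp only [this]
    rw [Complex.exp_re]
    simp only [Complex.add_re, Complex.add_im, Complex.mul_re, Complex.mul_im, Complex.ofReal_re, Complex.ofReal_im, Complex.I_re, Complex.I_im]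
    rw [← Real.cos_neg (x * u - τ * u ^ a)]
    ring_nf
  · refine setIntegral_congr_fun measurableSet_Ioi fun u _ => ?_
    have hI : -(Complex.I * ((π / 2 : ℝ) : ℂ)) = ((-(π / 2) : ℝ) : ℂ) * Complex.I := by
      push_cast; ring
    have e1 : Complex.exp (-(Complex.I * ((π / 2 : ℝ) : ℂ))) = -Complex.I := by
      rw [hI, Complex.exp_mul_I, ← Complex.ofReal_cos, ← Complex.ofReal_sin,
        Real.cos_neg, Real.sin_neg]
      simp
    have e2 : Complex.exp (-(Complex.I * (a * ((π / 2 : ℝ) : ℂ)))) =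
        cos (π * a / 2) - Complex.I * sin (π * a / 2) := by
      rw [show -(Complex.I * (a * ((π / 2 : ℝ) : ℂ))) = ((-(π * a / 2) : ℝ) : ℂ) * Complex.I by
        push_cast; ring, Complex.exp_mul_I, ← Complex.ofReal_cos, ← Complex.ofReal_sin,
        Real.cos_neg, Real.sin_neg]
      push_cast; ring
    have : rotE a τ x (π / 2) u = ((-x * u + -(cos (π * a / 2) - τ * sin (π * a / 2)) * u ^ a : ℝ) : ℂ)
        + (((sin (π * a / 2) + τ * cos (π * a / 2)) * u ^ a - π / 2 : ℝ) : ℂ) * Complex.I := by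
      rw [rotE, e2, e1]
      apply Complex.ext
      · simp [-Complex.ofReal_cos, -Complex.ofReal_sin]; ring
      · simp [-Complex.ofReal_cos, -Complex.ofReal_sin]; ring
    simp only [this]
    rw [Complex.exp_re]
    simp only [Complex.add_re, Complex.add_im, Complex.mul_re, Complex.mul_im, Complex.ofReal_re, Complex.ofReal_im, Complex.I_re, Complex.I_im]
    rw [← mul_assoc, ← Real.exp_add, show ∀ s : ℝ, 0 + ((s - π / 2) * 1 + 0 * 0) = s - π / 2 by intros; ring,
      Real.cos_sub_pi_div_two]
    ring_nf
    try simp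
theorem aux_int1 {q b : ℝ} (hq : -1 < q) (hb : 0 < b) :
    IntegrableOn (fun u : ℝ => u ^ q * rexp (-b * u)) (Ioi 0) := by
  simpa using aux_intOn (a := 1) (q := q) one_pos hq hb

theorem aux_val1 {q b : ℝ} (hq : -1 < q) (hb : 0 < b) :
    ∫ u in Ioi (0:ℝ), u ^ q * rexp (-b * u) = b ^ (-(q + 1)) * Real.Gamma (q + 1) := by
  simpa using integral_rpow_mul_exp_neg_mul_rpow (p := 1) (q := q) one_pos hq hb

/-- The integrand after rotation. -/
def hh (a A B u : ℝ) : ℝ := rexp (-A * u ^ a) * sin (B * u ^ a)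

theorem hh_cont (a A B : ℝ) (ha : 0 < a) : Continuous (hh a A B) := by
  have : Continuous (fun u : ℝ => u ^ a) := Real.continuous_rpow_const ha.le
  unfold hh
  fun_prop

theorem hh_abs {a A B u : ℝ} (ha0 : 0 < a) (ha1 : a ≤ 1) (hB : 0 < B) (hu : 0 ≤ u) :
    |hh a A B u| ≤ rexp (|A| + B) * B * (u ^ a * rexp ((|A| + B) * u)) := by
  have hs := aux_rpow_le ha0 ha1 hu
  have hs0 : 0 ≤ u ^ a := Real.rpow_nonneg hu a
  rw [hh, abs_mul, abs_of_pos (Real.exp_pos _)]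
  have h1 : |sin (B * u ^ a)| ≤ B * u ^ a := by
    have := Real.abs_sin_le_abs (x := B * u ^ a)
    rwa [abs_of_nonneg (by positivity : 0 ≤ B * u ^ a)] at this
  have h2 : rexp (-A * u ^ a) ≤ rexp (|A| + B) * rexp ((|A| + B) * u) := by
    rw [← Real.exp_add]
    apply Real.exp_le_exp.2
    have : -A * u ^ a ≤ |A| * u ^ a := mul_le_mul_of_nonneg_right (neg_le_abs A) hs0
    have h3 := mul_le_mul_of_nonneg_left hs (abs_nonneg A)
    nlinarith
  calc _ ≤ (rexp (|A| + B) * rexp ((|A| + B) * u)) * (B * u ^ a) :=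
      mul_le_mul h2 h1 (abs_nonneg _) (by positivity)
    _ = _ := by ring

theorem hh_lower {a A B u : ℝ} (ha0 : 0 < a) (ha1 : a ≤ 1) (hB : 0 < B) (hu : 0 ≤ u) :
    B * u ^ a - (|A| + B) ^ 2 * rexp (|A| + B) * (u ^ (2 * a) * rexp ((|A| + B) * u))
      ≤ hh a A B u := by
  have hs := aux_rpow_le ha0 ha1 hu
  have hs0 : 0 ≤ u ^ a := Real.rpow_nonneg hu a
  have h2a : u ^ (2 * a) = (u ^ a) ^ 2 := by
    rw [mul_comm, Real.rpow_mul hu]; norm_cast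
  rw [h2a, hh]
  set s := u ^ a
  set M := |A| + B
  have hM : 0 < M := by positivity
  set z : ℂ := ((-A * s : ℝ) : ℂ) + ((B * s : ℝ) : ℂ) * Complex.I with hz
  have hzn : ‖z‖ ≤ M * s := by
    refine (norm_add_le _ _).trans ?_
    rw [norm_mul, Complex.norm_I, Complex.norm_real, Complex.norm_real, Real.norm_eq_abs,
      Real.norm_eq_abs, abs_mul, abs_mul, abs_neg, abs_of_nonneg hs0, abs_of_pos hB]
    apply le_of_eq; ring
  have key := Complex.norm_exp_sub_sum_le_norm_mul_exp z 2
  have him := (Complex.abs_im_le_norm _).trans key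
  have e1 : (Complex.exp z - ∑ m ∈ Finset.range 2, z ^ m / (m.factorial : ℂ)).im =
      rexp (-A * s) * sin (B * s) - B * s := by
    simp only [Finset.sum_range_succ, Finset.sum_range_zero]
    rw [Complex.sub_im, Complex.exp_im]
    simp [hz]
  rw [e1] at him
  have h3 : ‖z‖ ^ 2 * rexp ‖z‖ ≤ (M * s) ^ 2 * (rexp M * rexp (M * u)) := by
    rw [← Real.exp_add]
    have : ‖z‖ ≤ M + M * u := hzn.trans (by nlinarith)
    gcongr
  have := (abs_le.1 him).1
  nlinarith

theorem aux_pow {x M q : ℝ} (hx : 2 * M ≤ x) (hx0 : 0 < x) (hq : 0 ≤ q) :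
    (x - M) ^ (-q) ≤ 2 ^ q * x ^ (-q) := by
  have h1 : (x - M) ^ (-q) ≤ (x / 2) ^ (-q) :=
    Real.rpow_le_rpow_of_nonpos (by linarith) (by linarith) (by linarith)
  refine h1.trans (le_of_eq ?_)
  rw [Real.div_rpow hx0.le (by norm_num), Real.rpow_neg (by norm_num : (0:ℝ) ≤ 2)]
  field_simp

theorem hh_int {a A B x : ℝ} (ha0 : 0 < a) (ha1 : a ≤ 1) (hB : 0 < B) (hx : |A| + B < x) :
    IntegrableOn (fun u => rexp (-x * u) * hh a A B u) (Ioi 0) := by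
  have h1 := (aux_int1 (q := a) (b := x - (|A| + B)) (by linarith) (by linarith)).const_mul
    (rexp (|A| + B) * B)
  refine h1.mono' ?_ ?_
  · have := hh_cont a A B ha0
    exact Continuous.aestronglyMeasurable (by fun_prop)
  · refine (ae_restrict_iff' measurableSet_Ioi).2 (Eventually.of_forall fun u hu => ?_)
    have hu' : 0 ≤ u := le_of_lt hu
    rw [norm_mul, Real.norm_eq_abs, Real.norm_eq_abs, abs_of_pos (Real.exp_pos _)]
    calc _ ≤ rexp (-x * u) * (rexp (|A| + B) * B * (u ^ a * rexp ((|A| + B) * u))) :=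
        mul_le_mul_of_nonneg_left (hh_abs ha0 ha1 hB hu') (Real.exp_pos _).le
      _ = rexp (|A| + B) * B * (u ^ a * (rexp (-x * u) * rexp ((|A| + B) * u))) := by ring
      _ = _ := by rw [← Real.exp_add]; ring_nf

theorem tail_lower {a A B : ℝ} (ha0 : 0 < a) (ha1 : a ≤ 1) (hB : 0 < B) :
    ∃ R c : ℝ, 0 < c ∧ ∀ x, R ≤ x →
      c * x ^ (-(1 + a)) ≤ ∫ u in Ioi (0:ℝ), rexp (-x * u) * hh a A B u := by
  set M := |A| + B with hMdef
  have hM : 0 < M := by positivity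
  have hG1 : 0 < Real.Gamma (a + 1) := Real.Gamma_pos_of_pos (by linarith)
  have hG2 : 0 < Real.Gamma (2 * a + 1) := Real.Gamma_pos_of_pos (by linarith)
  set D := M ^ 2 * rexp M * Real.Gamma (2 * a + 1) * 2 ^ (2 * a + 1) with hD
  have hlim : Tendsto (fun x : ℝ => D * x ^ (-a)) atTop (𝓝 0) := by
    simpa using (tendsto_rpow_neg_atTop ha0).const_mul D
  have hev := hlim.eventually (gt_mem_nhds (show 0 < B * Real.Gamma (a + 1) / 2 by positivity))
  obtain ⟨R, hR⟩ := eventually_atTop.1 hev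
  refine ⟨max R (max 1 (2 * M)), B * Real.Gamma (a + 1) / 2, by positivity, fun x hx => ?_⟩
  have hxR : R ≤ x := (le_max_left _ _).trans hx
  have hx1 : 1 ≤ x := (le_max_left _ _).trans ((le_max_right _ _).trans hx)
  have hxM : 2 * M ≤ x := (le_max_right _ _).trans ((le_max_right _ _).trans hx)
  have hx0 : 0 < x := by linarith
  have i1 := (aux_int1 (q := a) (b := x) (by linarith) hx0).const_mul B
  have i2 := (aux_int1 (q := 2 * a) (b := x - M) (by linarith) (by linarith)).const_mul
    (M ^ 2 * rexp M)
  have i3 := hh_int (a := a) (A := A) (B := B) (x := x) ha0 ha1 hB (by linarith)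
  have hle : ∫ u in Ioi (0:ℝ), (B * (u ^ a * rexp (-x * u)) -
      M ^ 2 * rexp M * (u ^ (2 * a) * rexp (-(x - M) * u))) ≤
      ∫ u in Ioi (0:ℝ), rexp (-x * u) * hh a A B u := by
    refine setIntegral_mono_on (i1.sub i2) i3 measurableSet_Ioi fun u hu => ?_
    have := mul_le_mul_of_nonneg_left (hh_lower (A := A) ha0 ha1 hB (le_of_lt hu))
      (Real.exp_pos (-x * u)).le
    refine le_trans (le_of_eq ?_) this
    rw [show -(x - M) * u = -x * u + M * u by ring, Real.exp_add (-x * u) (M * u), ← hMdef]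
    ring
  rw [integral_sub i1 i2, integral_const_mul, integral_const_mul, aux_val1 (by linarith) hx0,
    aux_val1 (by linarith) (by linarith)] at hle
  have hp := aux_pow (q := 2 * a + 1) hxM hx0 (by linarith)
  have hsplit : x ^ (-(2 * a + 1)) = x ^ (-a) * x ^ (-(1 + a)) := by
    rw [← Real.rpow_add hx0]; ring_nf
  have hRx := hR x hxR
  have hxp : 0 < x ^ (-(1 + a)) := Real.rpow_pos_of_pos hx0 _
  have h5 : M ^ 2 * rexp M * ((x - M) ^ (-(2 * a + 1)) * Real.Gamma (2 * a + 1)) ≤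
      B * Real.Gamma (a + 1) / 2 * x ^ (-(1 + a)) := by
    calc _ ≤ M ^ 2 * rexp M * ((2 ^ (2 * a + 1) * x ^ (-(2 * a + 1))) * Real.Gamma (2 * a + 1)) := by
          gcongr
      _ = (D * x ^ (-a)) * x ^ (-(1 + a)) := by rw [hsplit, hD]; ring
      _ ≤ _ := by gcongr
  have h6 : B * (x ^ (-(a + 1)) * Real.Gamma (a + 1)) = B * Real.Gamma (a + 1) * x ^ (-(1 + a)) := by
    rw [add_comm a 1]; ring
  linarith

theorem aux_exp_diff {x y u : ℝ} (hxy : x ≤ y) (hu : 0 ≤ u) :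
    |rexp (-x * u) - rexp (-y * u)| ≤ (y - x) * (u * rexp (-x * u)) := by
  have h1 : rexp (-y * u) ≤ rexp (-x * u) := Real.exp_le_exp.2 (by nlinarith)
  rw [abs_of_nonneg (by linarith)]
  have h2 : rexp (-y * u) = rexp (-x * u) * rexp (-((y - x) * u)) := by
    rw [← Real.exp_add]; ring_nf
  have h3 := Real.add_one_le_exp (-((y - x) * u))
  have h4 := mul_le_mul_of_nonneg_left h3 (Real.exp_pos (-x * u)).le
  rw [h2]
  nlinarith

theorem tail_inc {a A B : ℝ} (ha0 : 0 < a) (ha1 : a ≤ 1) (hB : 0 < B) :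
    ∃ R C : ℝ, 0 < C ∧ ∀ x y, R ≤ x → x ≤ y →
      |(∫ u in Ioi (0:ℝ), rexp (-x * u) * hh a A B u) -
        ∫ u in Ioi (0:ℝ), rexp (-y * u) * hh a A B u| ≤ C * (y - x) * x ^ (-(1 + a)) := by
  set M := |A| + B with hMdef
  have hM : 0 < M := by positivity
  have hG1 : 0 < Real.Gamma (1 + a + 1) := Real.Gamma_pos_of_pos (by linarith)
  refine ⟨max 1 (2 * M), rexp M * B * (2 ^ (1 + a + 1) * Real.Gamma (1 + a + 1)), by positivity,
    fun x y hx hxy => ?_⟩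
  have hx1 : 1 ≤ x := (le_max_left _ _).trans hx
  have hxM : 2 * M ≤ x := (le_max_right _ _).trans hx
  have hx0 : 0 < x := by linarith
  have i3 := hh_int (a := a) (A := A) (B := B) (x := x) ha0 ha1 hB (by linarith)
  have i4 := hh_int (a := a) (A := A) (B := B) (x := y) ha0 ha1 hB (by linarith)
  have i2 := (aux_int1 (q := 1 + a) (b := x - M) (by linarith) (by linarith)).const_mul
    ((y - x) * (rexp M * B))
  rw [← integral_sub i3 i4, ← Real.norm_eq_abs]
  have hle := norm_integral_le_of_norm_le i2
    (f := fun u => rexp (-x * u) * hh a A B u - rexp (-y * u) * hh a A B u) (by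
    refine (ae_restrict_iff' measurableSet_Ioi).2 (Eventually.of_forall fun u hu => ?_)
    have hu' : 0 < u := hu
    rw [← sub_mul, norm_mul, Real.norm_eq_abs, Real.norm_eq_abs]
    calc _ ≤ ((y - x) * (u * rexp (-x * u))) *
          (rexp (|A| + B) * B * (u ^ a * rexp ((|A| + B) * u))) :=
        mul_le_mul (aux_exp_diff hxy hu'.le) (hh_abs ha0 ha1 hB hu'.le) (abs_nonneg _)
          (by have := sub_nonneg.2 hxy; positivity)
      _ = _ := by
        rw [show -(x - M) * u = -x * u + M * u by ring, Real.exp_add (-x * u) (M * u), ← hMdef,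
          Real.rpow_add hu', Real.rpow_one]
        ring)
  refine hle.trans ?_
  rw [integral_const_mul, aux_val1 (by linarith) (by linarith)]
  have hp := aux_pow (q := 1 + a + 1) hxM hx0 (by linarith)
  have h1 : x ^ (-(1 + a + 1)) ≤ x ^ (-(1 + a)) :=
    Real.rpow_le_rpow_of_exponent_le hx1 (by linarith)
  have hyx := sub_nonneg.2 hxy
  calc _ ≤ (y - x) * (rexp M * B) * ((2 ^ (1 + a + 1) * x ^ (-(1 + a))) * Real.Gamma (1 + a + 1)) := by
        have h2 : (0:ℝ) < 2 ^ (1 + a + 1) := by positivity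
        have := hp.trans (mul_le_mul_of_nonneg_left h1 h2.le)
        gcongr
    _ = _ := by ring

/-- Combined tail estimate for `GG`. -/
theorem GG_tail {a τ : ℝ} (ha0 : 0 < a) (ha1 : a ≤ 1)
    (hB : 0 < sin (π * a / 2) + τ * cos (π * a / 2)) :
    ∃ R C : ℝ, 0 < R ∧ 0 < C ∧ (∀ x, R ≤ x → 0 < GG a τ x) ∧
      ∀ x y, R ≤ x → x ≤ y → |GG a τ x - GG a τ y| ≤ C * (y - x) * GG a τ x := by
  obtain ⟨R1, c, hc, H1⟩ := tail_lower (A := cos (π * a / 2) - τ * sin (π * a / 2)) ha0 ha1 hB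
  obtain ⟨R2, C, hC, H2⟩ := tail_inc (A := cos (π * a / 2) - τ * sin (π * a / 2)) ha0 ha1 hB
  have hrot : ∀ x, π * (|τ| + 1) / 2 ≤ x → GG a τ x = ∫ u in Ioi (0:ℝ), rexp (-x * u) *
      hh a (cos (π * a / 2) - τ * sin (π * a / 2)) (sin (π * a / 2) + τ * cos (π * a / 2)) u :=
    fun x hx => GG_rot ha0 ha1 hx
  have hpi := Real.pi_pos
  refine ⟨max (π * (|τ| + 1) / 2) (max R1 R2), C / c, lt_max_of_lt_left (by positivity),
    by positivity, ?_, ?_⟩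
  · intro x hx
    have hx0 := (le_max_left _ _).trans hx
    have hx1 := (le_max_left _ _).trans ((le_max_right _ _).trans hx)
    have hpos : 0 < x := lt_of_lt_of_le (by positivity) hx0
    rw [hrot x hx0]
    exact lt_of_lt_of_le (by positivity) (H1 x hx1)
  · intro x y hx hxy
    have hx0 := (le_max_left _ _).trans hx
    have hx1 := (le_max_left _ _).trans ((le_max_right _ _).trans hx)
    have hx2 := (le_max_right _ _).trans ((le_max_right _ _).trans hx)
    have hpos : 0 < x := lt_of_lt_of_le (by positivity) hx0
    rw [hrot x hx0, hrot y (hx0.trans hxy)]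
    refine (H2 x y hx2 hxy).trans ?_
    have := H1 x hx1
    have hyx := sub_nonneg.2 hxy
    calc _ = C / c * (y - x) * (c * x ^ (-(1 + a))) := by field_simp
      _ ≤ _ := by gcongr

theorem GG_int (a τ x : ℝ) (ha : 0 < a) :
    IntegrableOn (fun l : ℝ => rexp (-1 * l ^ a) * cos (x * l - τ * l ^ a)) (Ioi 0) := by
  have h0 := aux_intOn (q := 0) ha (by norm_num) one_pos
  refine Integrable.mono' h0 ?_ (Eventually.of_forall fun u => ?_)
  · have : Continuous (fun u : ℝ => u ^ a) := Real.continuous_rpow_const ha.le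
    exact Continuous.aestronglyMeasurable (by fun_prop)
  · rw [norm_mul, Real.norm_of_nonneg (Real.exp_pos _).le, Real.rpow_zero, one_mul]
    exact mul_le_of_le_one_right (Real.exp_pos _).le (Real.abs_cos_le_one _)

theorem GG_lip (a τ : ℝ) (ha : 0 < a) : ∃ L : ℝ, 0 < L ∧ ∀ x y,
    |GG a τ x - GG a τ y| ≤ L * |x - y| := by
  have h1 := aux_intOn (q := 1) ha (by norm_num) one_pos
  refine ⟨max 1 (∫ u in Ioi (0:ℝ), u ^ (1:ℝ) * rexp (-1 * u ^ a)), by positivity, fun x y => ?_⟩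
  rw [GG, GG, ← integral_sub (GG_int a τ x ha) (GG_int a τ y ha), ← Real.norm_eq_abs]
  have hle := norm_integral_le_of_norm_le (h1.mul_const |x - y|)
    (f := fun l : ℝ => rexp (-1 * l ^ a) * cos (x * l - τ * l ^ a) -
      rexp (-1 * l ^ a) * cos (y * l - τ * l ^ a)) (by
    refine (ae_restrict_iff' measurableSet_Ioi).2 (Eventually.of_forall fun u hu => ?_)
    have hu' : 0 < u := hu
    rw [← mul_sub, norm_mul, Real.norm_of_nonneg (Real.exp_pos _).le, Real.rpow_one, Real.norm_eq_abs]
    have h2 : |cos (x * u - τ * u ^ a) - cos (y * u - τ * u ^ a)| ≤ |x - y| * u := by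
      refine (Real.abs_cos_sub_cos_le _ _).trans (le_of_eq ?_)
      rw [show x * u - τ * u ^ a - (y * u - τ * u ^ a) = (x - y) * u by ring, abs_mul,
        abs_of_pos hu']
    calc _ ≤ rexp (-1 * u ^ a) * (|x - y| * u) :=
          mul_le_mul_of_nonneg_left h2 (Real.exp_pos _).le
      _ = _ := by ring)
  refine hle.trans ?_
  rw [integral_mul_const]
  exact mul_le_mul_of_nonneg_right (le_max_right _ _) (abs_nonneg _)

theorem GG_neg (a τ x : ℝ) : GG a τ (-x) = GG a (-τ) x := by
  unfold GG
  congr 1; ext l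
  rw [← Real.cos_neg (-x * l - τ * l ^ a)]
  ring_nf

/-- Abstract final estimate at unit time. -/
theorem GG_final {a τ : ℝ} (ha0 : 0 < a) (ha1 : a ≤ 1)
    (hB : 0 < sin (π * a / 2) + τ * cos (π * a / 2))
    (hB' : 0 < sin (π * a / 2) + (-τ) * cos (π * a / 2))
    (hpos : ∀ x, 0 < GG a τ x) :
    ∃ C > 0, ∀ x y, |GG a τ x - GG a τ y| ≤ C * min |x - y| 1 * (GG a τ x + GG a τ y) := by
  obtain ⟨R1, C1, hR1, hC1, -, H1⟩ := GG_tail ha0 ha1 hB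
  obtain ⟨R2, C2, hR2, hC2, -, H2⟩ := GG_tail ha0 ha1 hB'
  obtain ⟨L, hL, HL⟩ := GG_lip a τ ha0
  have hcont : Continuous (GG a τ) := by
    have : LipschitzWith ⟨L, hL.le⟩ (GG a τ) := LipschitzWith.of_dist_le_mul fun x y => by
      rw [Real.dist_eq, Real.dist_eq]; exact HL x y
    exact this.continuous
  set R := max R1 R2 + 1 with hR
  have hRp : 0 < R := by positivity
  obtain ⟨m, hm, hmin⟩ := (isCompact_Icc (a := -R) (b := R)).exists_isMinOn
    (nonempty_Icc.2 (by linarith)) hcont.continuousOn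
  have hc := hpos m
  set c := GG a τ m
  set C := max (max C1 C2) (max (L / c) 1) with hCdef
  have k1 : C1 ≤ C := (le_max_left _ _).trans (le_max_left _ _)
  have k2 : C2 ≤ C := (le_max_right _ _).trans (le_max_left _ _)
  have k3 : L / c ≤ C := (le_max_left _ _).trans (le_max_right _ _)
  have k4 : 1 ≤ C := (le_max_right _ _).trans (le_max_right _ _)
  have hC : 0 < C := by linarith
  refine ⟨C, hC, ?_⟩
  have wlog_le : ∀ x y, x ≤ y → |GG a τ x - GG a τ y| ≤ C * min |x - y| 1 * (GG a τ x + GG a τ y) := by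
    intro x y hxy
    have px := hpos x
    have py := hpos y
    rcases le_total 1 |x - y| with h | h
    · rw [min_eq_right h]
      have : |GG a τ x - GG a τ y| ≤ GG a τ x + GG a τ y := by
        rw [abs_le]; constructor <;> linarith
      nlinarith
    rw [min_eq_left h]
    have habs : |x - y| = y - x := by rw [abs_sub_comm, abs_of_nonneg (by linarith)]
    have hyx : 0 ≤ y - x := by linarith
    have m1 := le_max_left R1 R2
    have m2 := le_max_right R1 R2
    by_cases hx : R1 ≤ x
    · refine (H1 x y hx hxy).trans ?_
      rw [habs]
      gcongr
      linarith
    by_cases hy : y ≤ -R2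
    · have h3 := H2 (-y) (-x) (by linarith) (by linarith)
      rw [← GG_neg, ← GG_neg, neg_neg, neg_neg, abs_sub_comm] at h3
      refine h3.trans ?_
      rw [habs, show -x - -y = y - x by ring]
      gcongr
      linarith
    · push Not at hx hy
      have hcx : c ≤ GG a τ x := hmin ⟨by linarith, by linarith⟩
      calc _ ≤ L * |x - y| := HL x y
        _ = L / c * |x - y| * c := by field_simp
        _ ≤ C * |x - y| * (GG a τ x + GG a τ y) := by
          gcongr
          linarith
  intro x y
  rcases le_total x y with h | h
  · exact wlog_le x y h
  · have := wlog_le y x h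
    rwa [abs_sub_comm, abs_sub_comm y x, add_comm] at this
/-- Uniform form of the characteristic function. -/
def cfn (a τ t l : ℝ) : ℂ :=
  Complex.exp (((-(t * |l| ^ a) : ℝ) : ℂ) + ((t * |l| ^ a * τ * Real.sign l : ℝ) : ℂ) * Complex.I)

theorem cfn_norm (a τ t l : ℝ) : ‖cfn a τ t l‖ = rexp (-t * |l| ^ a) := by
  rw [cfn, Complex.norm_exp]; simp

theorem cfn_meas (a τ t : ℝ) : Measurable (cfn a τ t) := by
  have hs : Measurable Real.sign := by
    unfold Real.sign
    exact Measurable.ite measurableSet_Iio measurable_const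
      (Measurable.ite measurableSet_Ioi measurable_const measurable_const)
  unfold cfn
  fun_prop

theorem cfn_int (a τ t : ℝ) (ha : 0 < a) (ht : 0 < t) : Integrable (cfn a τ t) := by
  have h1 : Integrable (fun l : ℝ => rexp (-t * |l| ^ a)) := by
    by_contra h
    have h2 := integral_comp_abs (f := fun l : ℝ => rexp (-t * l ^ a))
    rw [integral_undef h, integral_exp_neg_mul_rpow ha ht] at h2
    have h3 : 0 < Real.Gamma (1 / a + 1) := Real.Gamma_pos_of_pos (by positivity)
    have : 0 < t ^ (-1 / a) * Real.Gamma (1 / a + 1) := by positivity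
    linarith
  exact h1.mono' (cfn_meas a τ t).aestronglyMeasurable
    (Eventually.of_forall fun l => (cfn_norm a τ t l).le)

/-- Hypothesis bundle for a density with the given characteristic function. -/
def IsDens (a τ t : ℝ) (f : ℝ → ℝ) : Prop :=
  (∀ x, 0 ≤ f x) ∧ Continuous f ∧
  ∀ l : ℝ, (∫ x : ℝ, Complex.exp (Complex.I * (l : ℂ) * (x : ℂ)) * ((f x : ℝ) : ℂ)) = cfn a τ t l

theorem IsDens.int {a τ t : ℝ} {f : ℝ → ℝ} (h : IsDens a τ t f) :
    Integrable (fun x => (f x : ℂ)) := by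
  by_contra hn
  have h0 := h.2.2 0
  simp only [Complex.ofReal_zero, mul_zero, zero_mul, Complex.exp_zero, one_mul] at h0
  rw [integral_undef hn] at h0
  exact Complex.exp_ne_zero _ h0.symm

theorem IsDens.inv {a τ t : ℝ} {f : ℝ → ℝ} (h : IsDens a τ t f) (ha : 0 < a) (ht : 0 < t)
    (x : ℝ) : (∫ l : ℝ, Complex.exp (-(Complex.I * x * l)) * cfn a τ t l) = 2 * π * f x := by
  have hpi := Real.pi_pos
  have hF : FourierTransform.fourier (fun x => (f x : ℂ)) = fun ξ : ℝ => cfn a τ t (-2 * π * ξ) := by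
    ext ξ
    rw [Real.fourier_real_eq_integral_exp_smul, ← h.2.2]
    congr 1; ext v
    rw [smul_eq_mul]
    congr 2
    push_cast; ring
  have hFi : Integrable (FourierTransform.fourier (fun x => (f x : ℂ))) := by
    rw [hF]
    exact (cfn_int a τ t ha ht).comp_mul_left' (by nlinarith)
  have key := (Complex.continuous_ofReal.comp h.2.1).continuousAt (x := x)
  have k2 := h.int.fourierInv_fourier_eq hFi key
  rw [Real.fourierInv_eq', hF] at k2
  have k3 := Measure.integral_comp_mul_left
    (fun l : ℝ => Complex.exp (-(Complex.I * x * l)) * cfn a τ t l) (-2 * π)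
  have k4 : (∫ v : ℝ, Complex.exp ((↑(2 * π * inner ℝ v x) : ℂ) * Complex.I) •
      cfn a τ t (-2 * π * v)) =
      ∫ v : ℝ, Complex.exp (-(Complex.I * x * ((-2 * π * v : ℝ) : ℂ))) * cfn a τ t (-2 * π * v) := by
    congr 1; ext v
    rw [smul_eq_mul]
    congr 2
    simp
    ring
  rw [k4] at k2
  rw [k3] at k2
  rw [← k2, Complex.real_smul, abs_inv, abs_mul, abs_neg, abs_of_pos hpi, abs_two]
  push_cast
  have : (π : ℂ) ≠ 0 := by exact_mod_cast hpi.ne'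
  field_simp

theorem IsDens.eq {a τ t : ℝ} {f : ℝ → ℝ} (h : IsDens a τ t f) (ha : 0 < a) (ht : 0 < t)
    (x : ℝ) : f x = 1 / π * ((t ^ (1 / a))⁻¹ * GG a τ (x / t ^ (1 / a))) := by
  have hpi := Real.pi_pos
  have hb : 0 < t ^ (1 / a) := by positivity
  have hinv := h.inv ha ht x
  have hint : Integrable (fun l : ℝ => Complex.exp (-(Complex.I * x * l)) * cfn a τ t l) := by
    refine (cfn_int a τ t ha ht).norm.mono' ?_ (Eventually.of_forall fun l => ?_)
    · exact (Continuous.aestronglyMeasurable (by fun_prop)).mul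
        (cfn_meas a τ t).aestronglyMeasurable
    · rw [norm_mul, Complex.norm_exp]; simp
  have hre := integral_re (𝕜 := ℂ) hint
  rw [hinv] at hre
  have e1 : RCLike.re ((2 * π * f x : ℂ)) = 2 * π * f x := by
    rw [RCLike.re_to_complex]
    exact_mod_cast Complex.ofReal_re (2 * π * f x)
  have e2 : (∫ l : ℝ, RCLike.re (Complex.exp (-(Complex.I * x * l)) * cfn a τ t l)) =
      ∫ l : ℝ, (fun l : ℝ => rexp (-t * l ^ a) * cos (x * l - t * τ * l ^ a)) |l| := by
    congr 1; ext l
    rw [cfn, ← Complex.exp_add, RCLike.re_to_complex,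
      show -(Complex.I * x * l) + (((-(t * |l| ^ a) : ℝ) : ℂ) +
        ((t * |l| ^ a * τ * Real.sign l : ℝ) : ℂ) * Complex.I) = ((-t * |l| ^ a : ℝ) : ℂ) +
        ((t * |l| ^ a * τ * Real.sign l - x * l : ℝ) : ℂ) * Complex.I by push_cast; ring,
      Complex.exp_re]
    simp only [Complex.add_re, Complex.add_im, Complex.mul_re, Complex.mul_im, Complex.ofReal_re,
      Complex.ofReal_im, Complex.I_re, Complex.I_im]
    ring_nf
    congr 1
    rcases lt_trichotomy l 0 with hl | hl | hl
    · rw [Real.sign_of_neg hl, abs_of_neg hl]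
      congr 1; ring
    · subst hl
      simp [Real.zero_rpow ha.ne']
    · rw [Real.sign_of_pos hl, abs_of_pos hl, ← Real.cos_neg]
      congr 1; ring
  rw [e1, e2, integral_comp_abs
    (f := fun l : ℝ => rexp (-t * l ^ a) * cos (x * l - t * τ * l ^ a))] at hre
  have hsc := integral_comp_mul_left_Ioi
    (fun l : ℝ => rexp (-1 * l ^ a) * cos (x / t ^ (1 / a) * l - τ * l ^ a)) 0 hb
  rw [mul_zero, smul_eq_mul] at hsc
  have e3 : (∫ l in Ioi (0:ℝ), rexp (-t * l ^ a) * cos (x * l - t * τ * l ^ a)) =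
      (t ^ (1 / a))⁻¹ * GG a τ (x / t ^ (1 / a)) := by
    rw [GG, ← hsc]
    refine setIntegral_congr_fun measurableSet_Ioi fun l hl => ?_
    have hl' : 0 ≤ l := le_of_lt hl
    have hp : (t ^ (1 / a) * l) ^ a = t * l ^ a := by
      rw [Real.mul_rpow hb.le hl', ← Real.rpow_mul ht.le, one_div_mul_cancel ha.ne', Real.rpow_one]
    simp only [hp]
    congr 2
    · ring
    · field_simp
  rw [e3] at hre
  field_simp at hre ⊢
  linarith

theorem IsDens.conv {a τ : ℝ} {f q : ℝ → ℝ} (hf : IsDens a τ 1 f) (hq : IsDens a τ (1 / 2) q)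
    (ha : 0 < a) (x : ℝ) :
    Integrable (fun y => q y * q (x - y)) ∧ f x = ∫ y, q y * q (x - y) := by
  have hpi := Real.pi_pos
  have hh2 : (0:ℝ) < 1 / 2 := by norm_num
  have hprod : Integrable (Function.uncurry fun l y : ℝ =>
      Complex.exp (-(Complex.I * x * l)) * cfn a τ (1 / 2) l *
        (Complex.exp (Complex.I * l * y) * (q y : ℂ))) (volume.prod volume) := by
    have h1 := (cfn_int a τ (1 / 2) ha hh2).mul_prod hq.int
    refine h1.norm.mono' ?_ (Eventually.of_forall fun z => ?_)
    · have m1 : Measurable (fun z : ℝ × ℝ => cfn a τ (1 / 2) z.1) :=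
        (cfn_meas a τ (1 / 2)).comp measurable_fst
      have m2 : Measurable (fun z : ℝ × ℝ => q z.2) :=
        hq.2.1.measurable.comp measurable_snd
      have m3 : Measurable (fun z : ℝ × ℝ => Complex.exp (-(Complex.I * x * z.1))) :=
        Continuous.measurable (by fun_prop)
      have m4 : Measurable (fun z : ℝ × ℝ => Complex.exp (Complex.I * z.1 * z.2)) :=
        Continuous.measurable (by fun_prop)
      exact ((m3.mul m1).mul (m4.mul (Complex.measurable_ofReal.comp m2))).aestronglyMeasurable
    · simp only [Function.uncurry]
      rw [norm_mul, norm_mul, norm_mul, norm_mul, Complex.norm_exp, Complex.norm_exp]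
      simp
  have hsw := integral_integral_swap hprod
  have hy : ∀ y : ℝ, (∫ l : ℝ, Complex.exp (-(Complex.I * x * l)) * cfn a τ (1 / 2) l *
        (Complex.exp (Complex.I * l * y) * (q y : ℂ))) =
        ((2 * π * (q y * q (x - y)) : ℝ) : ℂ) := by
    intro y
    have h1 := hq.inv ha hh2 (x - y)
    calc _ = ∫ l : ℝ, (Complex.exp (-(Complex.I * ((x - y : ℝ) : ℂ) * l)) *
          cfn a τ (1 / 2) l) * (q y : ℂ) := by
          congr 1; ext l
          rw [show -(Complex.I * ((x - y : ℝ) : ℂ) * l) = -(Complex.I * x * l) + Complex.I * l * y by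
            push_cast; ring, Complex.exp_add]
          ring
      _ = _ := by
          rw [integral_mul_const, h1]; push_cast; ring
  have hint := hprod.integral_prod_right
  simp only [Function.uncurry] at hint
  simp_rw [hy] at hint hsw
  have hl : ∀ l : ℝ, (∫ y : ℝ, Complex.exp (-(Complex.I * x * l)) * cfn a τ (1 / 2) l *
        (Complex.exp (Complex.I * l * y) * (q y : ℂ))) =
        Complex.exp (-(Complex.I * x * l)) * cfn a τ 1 l := by
    intro l
    rw [integral_const_mul, hq.2.2 l, mul_assoc]
    congr 1
    rw [cfn, cfn, ← Complex.exp_add]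
    congr 1
    push_cast; ring
  simp_rw [hl] at hsw
  rw [hf.inv ha one_pos, integral_complex_ofReal, integral_const_mul] at hsw
  have hr : 2 * π * f x = 2 * π * ∫ y, q y * q (x - y) := by exact_mod_cast hsw
  refine ⟨?_, mul_left_cancel₀ (by positivity) hr⟩
  have h3 := (hint.re).const_mul (2 * π)⁻¹
  refine h3.congr (Eventually.of_forall fun y => ?_)
  simp only [RCLike.re_to_complex, Complex.ofReal_re]
  field_simp

theorem GG_pos {a τ : ℝ} {f q : ℝ → ℝ} (hf : IsDens a τ 1 f) (hq : IsDens a τ (1 / 2) q)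
    (ha0 : 0 < a) (ha1 : a ≤ 1)
    (hB : 0 < sin (π * a / 2) + τ * cos (π * a / 2))
    (hB' : 0 < sin (π * a / 2) + (-τ) * cos (π * a / 2)) (x : ℝ) : 0 < GG a τ x := by
  have hpi := Real.pi_pos
  have h1 : f x = 1 / π * GG a τ x := by simpa using hf.eq ha0 one_pos x
  obtain ⟨R1, -, -, -, H1, -⟩ := GG_tail ha0 ha1 hB
  obtain ⟨R2, -, -, -, H2, -⟩ := GG_tail ha0 ha1 hB'
  obtain ⟨hint, heq⟩ := hf.conv hq ha0 x
  have hfpos : 0 < f x := by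
    refine lt_of_le_of_ne (hf.1 x) fun h0 => ?_
    rw [heq, eq_comm, integral_eq_zero_iff_of_nonneg
      (fun y => mul_nonneg (hq.1 _) (hq.1 _)) hint] at h0
    have hc : Continuous (fun y => q y * q (x - y)) := by
      have := hq.2.1
      fun_prop
    have h0' := (Continuous.ae_eq_iff_eq volume hc continuous_const).1 h0
    set b : ℝ := (1 / 2 : ℝ) ^ (1 / a)
    have hb : 0 < b := by positivity
    set y := max (R1 * b) (x + R2 * b)
    have hy1 : R1 ≤ y / b := by
      rw [le_div_iff₀ hb]; exact le_max_left _ _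
    have hy2 : R2 ≤ (y - x) / b := by
      rw [le_div_iff₀ hb]; have := le_max_right (R1 * b) (x + R2 * b); linarith
    have q1 : 0 < q y := by
      rw [hq.eq ha0 (by norm_num)]
      have := H1 _ hy1
      positivity
    have q2 : 0 < q (x - y) := by
      rw [hq.eq ha0 (by norm_num), show (x - y) / b = -((y - x) / b) by ring, GG_neg]
      have := H2 _ hy2
      positivity
    have := congrFun h0' y
    have h3 : q y * q (x - y) = 0 := this
    have := mul_pos q1 q2
    linarith
  rw [h1] at hfpos
  exact (pos_iff_pos_of_mul_pos hfpos).1 (by positivity)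

theorem stableCF_eq {α δ : ℝ} (h1 : α = 1 → δ = 0) (t l : ℝ) :
    stableCF α δ t l = cfn α (δ * Real.tan (π * α / 2)) t l := by
  unfold stableCF cfn
  split_ifs with h
  · rw [h1 h, h]; simp
  · congr 1
    push_cast; ring

/-- Lemma 2.1 (3): Hölder-type estimate for the stable densities. -/
theorem stable_density_increment_bound
    (α δ : ℝ) (hα0 : 0 < α) (hα1 : α ≤ 1) (hδ : δ ∈ Set.Ioo (-1 : ℝ) 1)
    (h1 : α = 1 → δ = 0)
    (p : ℝ → ℝ → ℝ)
    (hp : ∀ t : ℝ, 0 < t → (∀ x, 0 ≤ p t x) ∧ Continuous (p t) ∧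
      ∀ l : ℝ, (∫ x : ℝ, Complex.exp (Complex.I * (l : ℂ) * (x : ℂ)) * ((p t x : ℝ) : ℂ))
        = stableCF α δ t l) :
    ∃ C > 0, ∀ t : ℝ, 0 < t → ∀ x y : ℝ,
      |p t x - p t y| ≤ C * min (|x - y| / t ^ (1/α)) 1 * (p t x + p t y) := by
  set τ := δ * Real.tan (π * α / 2) with hτ
  have hD : ∀ t, 0 < t → IsDens α τ t (p t) := fun t ht =>
    ⟨(hp t ht).1, (hp t ht).2.1, fun l => by rw [(hp t ht).2.2 l, stableCF_eq h1]⟩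
  have hpi := Real.pi_pos
  have hsin : 0 < sin (π * α / 2) := Real.sin_pos_of_pos_of_lt_pi (by positivity) (by nlinarith)
  have hτc : τ * cos (π * α / 2) = δ * sin (π * α / 2) := by
    rcases hα1.lt_or_eq with h | h
    · have hc : 0 < cos (π * α / 2) :=
        Real.cos_pos_of_mem_Ioo ⟨by nlinarith, by nlinarith⟩
      rw [hτ, Real.tan_eq_sin_div_cos]
      field_simp
    · simp [hτ, h1 h]
  have hB : 0 < sin (π * α / 2) + τ * cos (π * α / 2) := by
    rw [hτc]; nlinarith [hδ.1]
  have hB' : 0 < sin (π * α / 2) + (-τ) * cos (π * α / 2) := by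
    rw [neg_mul, hτc]; nlinarith [hδ.2]
  obtain ⟨C, hC, H⟩ := GG_final hα0 hα1 hB hB'
    (GG_pos (hD 1 one_pos) (hD (1 / 2) (by norm_num)) hα0 hα1 hB hB')
  refine ⟨C, hC, fun t ht x y => ?_⟩
  have hb : 0 < t ^ (1 / α) := by positivity
  rw [(hD t ht).eq hα0 ht x, (hD t ht).eq hα0 ht y]
  set b := t ^ (1 / α)
  have h2 := H (x / b) (y / b)
  rw [show x / b - y / b = (x - y) / b by ring, abs_div, abs_of_pos hb] at h2
  rw [← mul_sub, ← mul_sub, ← mul_add, ← mul_add, abs_mul, abs_mul,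
    abs_of_pos (show 0 < 1 / π by positivity), abs_of_pos (show 0 < b⁻¹ by positivity)]
  calc _ ≤ 1 / π * (b⁻¹ * (C * min (|x - y| / b) 1 * (GG α τ (x / b) + GG α τ (y / b)))) := by
        gcongr
    _ = _ := by ring
end
end

section
/- Let α ∈ (0,1] and δ = 0, and let p_t be the density of the symmetric α-stable law with characteristic function λ ↦ exp(−t|λ|^α). Then for every k ∈ ℕ there is a constant C_α > 0 such that for all t > 0 and x ∈ ℝ, |∂_x^k p_t(x)| ≤ C_α t / (t^{1/α} + |x|)^{α+1+k}. -/
open MeasureTheory Real Filter Set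
open scoped Topology

noncomputable section

theorem exp_image_univ_aux : Real.exp '' univ = Ioi 0 := by
  rw [image_univ, Real.range_exp]

theorem integral_exp_cov {E : Type*} [NormedAddCommGroup E] [NormedSpace ℝ E] (F : ℝ → E) :
    ∫ u : ℝ, Real.exp u • F (Real.exp u) = ∫ z in Ioi (0:ℝ), F z := by
  have h := integral_image_eq_integral_abs_deriv_smul (s := univ) (f := Real.exp) (f' := Real.exp)
    MeasurableSet.univ (fun x _ => (Real.hasDerivAt_exp x).hasDerivWithinAt)
    Real.exp_injective.injOn F
  rw [exp_image_univ_aux] at h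
  rw [h]
  simp [abs_of_pos (Real.exp_pos _)]

theorem integrable_exp_cov {E : Type*} [NormedAddCommGroup E] [NormedSpace ℝ E] (F : ℝ → E) :
    Integrable (fun u : ℝ => Real.exp u • F (Real.exp u)) ↔ IntegrableOn F (Ioi (0:ℝ)) := by
  have h := integrableOn_image_iff_integrableOn_abs_deriv_smul (s := univ) (f := Real.exp)
    (f' := Real.exp)
    MeasurableSet.univ (fun x _ => (Real.hasDerivAt_exp x).hasDerivWithinAt)
    Real.exp_injective.injOn F
  rw [exp_image_univ_aux] at h
  rw [h]
  simp [abs_of_pos (Real.exp_pos _)]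

/-- the integrand after the substitution `z = exp w` -/
def gfun (α : ℝ) (k : ℕ) (t x : ℝ) (w : ℂ) : ℂ :=
  Complex.exp (((k:ℂ)+1) * w + Complex.I * (x:ℂ) * Complex.exp w - (t:ℂ) * Complex.exp ((α:ℂ) * w))

def Bfun (α : ℝ) (k : ℕ) (c : ℝ) (u : ℝ) : ℝ :=
  Real.exp (((k:ℝ)+1) * u - c * Real.exp (α * u))

theorem Bfun_eq (α : ℝ) (k : ℕ) (c : ℝ) (u : ℝ) :
    Bfun α k c u = Real.exp u • ((Real.exp u) ^ (k:ℝ) * Real.exp (-c * (Real.exp u) ^ α)) := by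
  unfold Bfun
  rw [← Real.exp_mul, ← Real.exp_mul, smul_eq_mul, ← Real.exp_add, ← Real.exp_add]
  congr 1
  rw [mul_comm u α]
  ring

theorem Bfun_integrable {α : ℝ} (hα : 0 < α) (k : ℕ) {c : ℝ} (hc : 0 < c) :
    Integrable (Bfun α k c) := by
  have := (integrable_exp_cov (fun z : ℝ => z ^ (k:ℝ) * Real.exp (-c * z ^ α))).2
    (integrableOn_rpow_mul_exp_neg_mul_rpow (by have : (0:ℝ) ≤ k := Nat.cast_nonneg k
                                                linarith) hα hc)
  exact this.congr (Eventually.of_forall fun u => (Bfun_eq α k c u).symm)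

theorem Bfun_tendsto_atTop {α : ℝ} (hα : 0 < α) (k : ℕ) {c : ℝ} (hc : 0 < c) :
    Tendsto (Bfun α k c) atTop (𝓝 0) := by
  have h1 := tendsto_rpow_mul_exp_neg_mul_atTop_nhds_zero (((k:ℝ)+1)/α) c hc
  have h2 : Tendsto (fun u : ℝ => Real.exp (α * u)) atTop atTop :=
    Real.tendsto_exp_atTop.comp (tendsto_id.const_mul_atTop hα)
  refine (h1.comp h2).congr fun u => ?_
  simp only [Function.comp, Bfun]
  rw [← Real.exp_mul, ← Real.exp_add]
  congr 1
  field_simp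
  ring

theorem Bfun_tendsto_atBot {α : ℝ} (k : ℕ) {c : ℝ} (hc : 0 < c) :
    Tendsto (Bfun α k c) atBot (𝓝 0) := by
  have h2 : Tendsto (fun u : ℝ => Real.exp (((k:ℝ)+1) * u)) atBot (𝓝 0) :=
    Real.tendsto_exp_atBot.comp (tendsto_id.const_mul_atBot (by positivity))
  refine squeeze_zero (fun u => (Real.exp_pos _).le) (fun u => ?_) h2
  apply Real.exp_le_exp.2
  have : 0 < c * Real.exp (α * u) := by positivity
  linarith

theorem gfun_norm (α : ℝ) (k : ℕ) (t x u θ : ℝ) :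
    ‖gfun α k t x (u + θ * Complex.I)‖ = Real.exp (((k:ℝ)+1) * u -
      (x * Real.exp u * Real.sin θ + t * Real.exp (α * u) * Real.cos (α * θ))) := by
  unfold gfun
  rw [Complex.norm_exp]
  congr 1
  have e1 : Complex.exp (u + θ * Complex.I) = (Real.exp u * Real.cos θ : ℝ) +
      (Real.exp u * Real.sin θ : ℝ) * Complex.I := by
    rw [Complex.exp_add, Complex.exp_mul_I]; push_cast; ring
  have e2 : Complex.exp ((α:ℂ) * (u + θ * Complex.I)) = (Real.exp (α*u) * Real.cos (α*θ) : ℝ) +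
      (Real.exp (α*u) * Real.sin (α*θ) : ℝ) * Complex.I := by
    rw [show (α:ℂ) * (u + θ * Complex.I) = (α * u : ℝ) + (α * θ : ℝ) * Complex.I by push_cast; ring,
      Complex.exp_add, Complex.exp_mul_I]; push_cast; ring
  rw [e1, e2]
  simp [-Complex.ofReal_exp, -Complex.ofReal_mul, -Complex.ofReal_cos, -Complex.ofReal_sin]
  ring

theorem exists_c {α : ℝ} (hα0 : 0 < α) (hα1 : α ≤ 1) {t x : ℝ} (ht : 0 < t) (hx : 0 < x) :
    ∃ c > 0, ∀ θ ∈ Icc 0 (π/2), ∀ u : ℝ,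
      c * Real.exp (α * u) ≤
        x * Real.exp u * Real.sin θ + t * Real.exp (α * u) * Real.cos (α * θ) := by
  rcases eq_or_lt_of_le hα1 with h | h
  · subst h
    refine ⟨min x t, lt_min hx ht, fun θ hθ u => ?_⟩
    have hs : 0 ≤ Real.sin θ := Real.sin_nonneg_of_nonneg_of_le_pi hθ.1 (by linarith [hθ.2, pi_pos])
    have hc : 0 ≤ Real.cos θ := Real.cos_nonneg_of_neg_pi_div_two_le_of_le
      (by linarith [hθ.1, pi_pos]) hθ.2
    have h1 : 1 ≤ Real.sin θ + Real.cos θ := by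
      nlinarith [Real.sin_sq_add_cos_sq θ, mul_nonneg hs hc]
    rw [one_mul, one_mul]
    have : min x t ≤ x * Real.sin θ + t * Real.cos θ := by
      nlinarith [min_le_left x t, min_le_right x t, lt_min hx ht]
    nlinarith [Real.exp_pos u]
  · refine ⟨t * Real.cos (α * (π/2)), mul_pos ht (Real.cos_pos_of_mem_Ioo ⟨?_, ?_⟩), fun θ hθ u => ?_⟩
    · nlinarith [pi_pos]
    · nlinarith [pi_pos]
    · have hs : 0 ≤ Real.sin θ :=
        Real.sin_nonneg_of_nonneg_of_le_pi hθ.1 (by linarith [hθ.2, pi_pos])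
      have : Real.cos (α * (π/2)) ≤ Real.cos (α * θ) := by
        apply Real.cos_le_cos_of_nonneg_of_le_pi
        · exact mul_nonneg hα0.le hθ.1
        · nlinarith [pi_pos]
        · exact mul_le_mul_of_nonneg_left hθ.2 hα0.le
      have h2 : 0 ≤ x * Real.exp u * Real.sin θ := by positivity
      have h3 : 0 < t * Real.exp (α * u) := by positivity
      nlinarith

theorem gfun_diff (α : ℝ) (k : ℕ) (t x : ℝ) : Differentiable ℂ (gfun α k t x) := by
  unfold gfun
  fun_prop

theorem gfun_integrable {α : ℝ} (hα0 : 0 < α) (hα1 : α ≤ 1) (k : ℕ) {t x : ℝ} (ht : 0 < t)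
    (hx : 0 < x) {θ : ℝ} (hθ : θ ∈ Icc 0 (π/2)) :
    Integrable (fun u : ℝ => gfun α k t x (u + θ * Complex.I)) := by
  obtain ⟨c, hc, hb⟩ := exists_c hα0 hα1 ht hx
  refine (Bfun_integrable hα0 k hc).mono' ?_ (Eventually.of_forall fun u => ?_)
  · exact ((gfun_diff α k t x).continuous.comp (by fun_prop)).aestronglyMeasurable
  · rw [gfun_norm, Bfun]
    apply Real.exp_le_exp.2
    linarith [hb θ hθ u]

theorem gfun_rotate {α : ℝ} (hα0 : 0 < α) (hα1 : α ≤ 1) (k : ℕ) {t x : ℝ} (ht : 0 < t)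
    (hx : 0 < x) :
    ∫ u : ℝ, gfun α k t x u = ∫ u : ℝ, gfun α k t x (u + (π/2 : ℝ) * Complex.I) := by
  obtain ⟨c, hc, hb⟩ := exists_c hα0 hα1 ht hx
  have hπ := pi_pos
  have i0 := gfun_integrable hα0 hα1 k ht hx (θ := 0) ⟨le_rfl, by positivity⟩
  have i1 := gfun_integrable hα0 hα1 k ht hx (θ := π/2) ⟨by positivity, le_rfl⟩
  have t0 := intervalIntegral_tendsto_integral i0 tendsto_neg_atTop_atBot tendsto_id
  have t1 := intervalIntegral_tendsto_integral i1 tendsto_neg_atTop_atBot tendsto_id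
  have bd : ∀ u : ℝ, ‖∫ y in (0:ℝ)..(π/2), gfun α k t x (u + y * Complex.I)‖ ≤
      Bfun α k c u * (π/2) := by
    intro u
    have := intervalIntegral.norm_integral_le_of_norm_le_const (a := 0) (b := π/2)
      (f := fun y : ℝ => gfun α k t x (u + y * Complex.I)) (C := Bfun α k c u) ?_
    · rwa [sub_zero, abs_of_pos (by positivity)] at this
    · intro y hy
      rw [uIoc_of_le (by positivity)] at hy
      rw [gfun_norm, Bfun]
      apply Real.exp_le_exp.2
      linarith [hb y ⟨hy.1.le, hy.2⟩ u]
  have v1 : Tendsto (fun R : ℝ => ∫ y in (0:ℝ)..(π/2), gfun α k t x ((R:ℝ) + y * Complex.I))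
      atTop (𝓝 0) := by
    refine squeeze_zero_norm bd ?_
    simpa using (Bfun_tendsto_atTop hα0 k hc).mul_const (π/2)
  have v0 : Tendsto (fun R : ℝ => ∫ y in (0:ℝ)..(π/2), gfun α k t x ((-R:ℝ) + y * Complex.I))
      atTop (𝓝 0) := by
    refine squeeze_zero_norm (fun R => bd (-R)) ?_
    simpa using ((Bfun_tendsto_atBot k hc).comp tendsto_neg_atTop_atBot).mul_const (π/2)
  have key : ∀ R : ℝ, (∫ u in (-R)..R, gfun α k t x (u + (0:ℝ) * Complex.I)) -
      (∫ u in (-R)..R, gfun α k t x (u + (π/2:ℝ) * Complex.I)) +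
      Complex.I • (∫ y in (0:ℝ)..(π/2), gfun α k t x ((R:ℝ) + y * Complex.I)) -
      Complex.I • (∫ y in (0:ℝ)..(π/2), gfun α k t x ((-R:ℝ) + y * Complex.I)) = 0 := by
    intro R
    have := Complex.integral_boundary_rect_eq_zero_of_differentiableOn (gfun α k t x)
      ⟨-R, 0⟩ ⟨R, π/2⟩ (gfun_diff α k t x).differentiableOn
    simpa only using this
  have lim := ((t0.sub t1).add (v1.const_smul Complex.I)).sub (v0.const_smul Complex.I)
  simp only [id] at lim
  have lim2 := lim.congr key
  have := tendsto_nhds_unique lim2 tendsto_const_nhds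
  simp only [smul_zero, add_zero, sub_zero] at this
  rw [sub_eq_zero] at this
  simpa using this

def Kfun (α : ℝ) (k : ℕ) (t x : ℝ) : ℂ :=
  ∫ z in Ioi (0:ℝ), (z:ℂ) ^ k * Complex.exp (Complex.I * x * z - t * ((z ^ α : ℝ) : ℂ))

theorem Kfun_eq (α : ℝ) (k : ℕ) (t x : ℝ) : Kfun α k t x = ∫ u : ℝ, gfun α k t x u := by
  unfold Kfun
  rw [← integral_exp_cov]
  congr 1
  ext u
  unfold gfun
  rw [Complex.real_smul, ← Real.exp_mul, mul_comm u α]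
  push_cast
  rw [← Complex.exp_nat_mul, ← Complex.exp_add, ← Complex.exp_add]
  congr 1
  ring

theorem Kfun_norm_le {α : ℝ} (hα : 0 < α) (k : ℕ) {t : ℝ} (ht : 0 < t) (x : ℝ) :
    ‖Kfun α k t x‖ ≤ t ^ (-((k:ℝ) + 1) / α) * (1 / α) * Real.Gamma (((k:ℝ) + 1) / α) := by
  have hk : (0:ℝ) ≤ k := Nat.cast_nonneg k
  rw [← integral_rpow_mul_exp_neg_mul_rpow hα (q := k) (by linarith) ht]
  unfold Kfun
  refine (norm_integral_le_integral_norm _).trans (le_of_eq ?_)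
  refine setIntegral_congr_fun measurableSet_Ioi fun z hz => ?_
  have hz : 0 < z := hz
  rw [norm_mul, norm_pow, Complex.norm_exp, Complex.norm_real, Real.norm_of_nonneg hz.le,
    Real.rpow_natCast]
  congr 2
  simp

theorem gfun_rot_im (α : ℝ) (k : ℕ) (t x u : ℝ) :
    gfun α k t x (u + (π/2 : ℝ) * Complex.I) = Complex.I ^ (k+1) *
      Complex.exp (((((k:ℝ)+1) * u - x * Real.exp u
        - t * Real.exp (α * u) * Real.cos (α * (π/2)) : ℝ) : ℂ)
        + ((-(t * Real.exp (α * u) * Real.sin (α * (π/2))) : ℝ) : ℂ) * Complex.I) := by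
  have hI : Complex.exp ((π/2 : ℝ) * Complex.I) = Complex.I := by
    push_cast; exact Complex.exp_pi_div_two_mul_I
  have e1 : Complex.exp (u + (π/2 : ℝ) * Complex.I) = Complex.I * Real.exp u := by
    rw [Complex.exp_add, hI]; push_cast; ring
  have e2 : Complex.exp ((α:ℂ) * (u + (π/2 : ℝ) * Complex.I)) =
      (Real.exp (α*u) * Real.cos (α*(π/2)) : ℝ) +
      (Real.exp (α*u) * Real.sin (α*(π/2)) : ℝ) * Complex.I := by
    rw [show (α:ℂ) * (u + (π/2 : ℝ) * Complex.I) = (α * u : ℝ) + (α * (π/2) : ℝ) * Complex.I by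
      push_cast; ring, Complex.exp_add, Complex.exp_mul_I]; push_cast; ring
  have e3 : Complex.I ^ (k+1) = Complex.exp (((k+1 : ℕ) : ℂ) * ((π/2 : ℝ) * Complex.I)) := by
    rw [Complex.exp_nat_mul, hI]
  unfold gfun
  rw [e1, e2, e3, ← Complex.exp_add]
  congr 1
  push_cast
  linear_combination (x * Complex.exp u) * Complex.I_mul_I

theorem Kfun_re_le {α : ℝ} (hα0 : 0 < α) (hα1 : α ≤ 1) (k : ℕ) {t x : ℝ} (ht : 0 < t)
    (hx : 0 < x) :
    |(Complex.I ^ k * Kfun α k t x).re| ≤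
      t * ((1 / x) ^ (α + 1 + k) * Real.Gamma (α + 1 + k)) := by
  have hk : (0:ℝ) ≤ k := Nat.cast_nonneg k
  set h : ℝ → ℂ := fun u => Complex.exp (((((k:ℝ)+1) * u - x * Real.exp u
        - t * Real.exp (α * u) * Real.cos (α * (π/2)) : ℝ) : ℂ)
        + ((-(t * Real.exp (α * u) * Real.sin (α * (π/2))) : ℝ) : ℂ) * Complex.I) with hh
  have hK : Kfun α k t x = Complex.I ^ (k+1) * ∫ u, h u := by
    rw [Kfun_eq, gfun_rotate hα0 hα1 k ht hx, ← integral_const_mul]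
    congr 1
    ext u
    exact gfun_rot_im α k t x u
  have hInt : Integrable h := by
    have i1 := gfun_integrable hα0 hα1 k ht hx (θ := π/2) ⟨by positivity, le_rfl⟩
    have : (fun u : ℝ => gfun α k t x (u + (π/2 : ℝ) * Complex.I)) =
        fun u => Complex.I ^ (k+1) * h u := by
      ext u; exact gfun_rot_im α k t x u
    rw [this] at i1
    exact (integrable_const_mul_iff (IsUnit.mk0 _ (pow_ne_zero _ Complex.I_ne_zero)) _).1 i1
  have h1 : |(Complex.I ^ k * Kfun α k t x).re| = |(∫ u, h u).im| := by
    rw [hK, ← mul_assoc, ← pow_add, show k + (k+1) = 2*k+1 by ring, pow_succ, pow_mul,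
      Complex.I_sq]
    rcases neg_one_pow_eq_or ℂ k with h | h <;> rw [h] <;> simp
  have h2 : (∫ u, h u).im = ∫ u, (h u).im := by
    have := integral_im hInt
    simpa using this.symm
  have hcos : 0 ≤ Real.cos (α * (π/2)) := by
    apply Real.cos_nonneg_of_neg_pi_div_two_le_of_le
    · nlinarith [pi_pos]
    · nlinarith [pi_pos]
  have hG : t * ((1 / x) ^ (α + 1 + k) * Real.Gamma (α + 1 + k)) =
      ∫ u : ℝ, Real.exp u • (t * (Real.exp u ^ (α + 1 + k - 1) * Real.exp (-(x * Real.exp u)))) := by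
    rw [integral_exp_cov (fun z : ℝ => t * (z ^ (α + 1 + k - 1) * Real.exp (-(x * z)))),
      integral_const_mul, Real.integral_rpow_mul_exp_neg_mul_Ioi (by positivity) hx]
  rw [h1, h2, hG, ← Real.norm_eq_abs]
  refine norm_integral_le_of_norm_le ?_ (Eventually.of_forall fun u => ?_)
  · rw [integrable_exp_cov (fun z : ℝ => t * (z ^ (α + 1 + k - 1) * Real.exp (-(x * z))))]
    refine Integrable.const_mul ?_ t
    have := integrableOn_rpow_mul_exp_neg_mul_rpow (p := 1) (s := α + 1 + k - 1) (b := x)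
      (by linarith) one_pos hx
    simpa [IntegrableOn] using this
  · rw [hh]
    simp only
    rw [Complex.exp_im]
    simp only [Complex.add_re, Complex.add_im, Complex.ofReal_re, Complex.ofReal_im,
      Complex.re_ofReal_mul, Complex.im_ofReal_mul, Complex.I_re, Complex.I_im, mul_zero, add_zero,
      mul_one, zero_add]
    rw [norm_mul, Real.norm_eq_abs, Real.norm_eq_abs, Real.abs_exp, smul_eq_mul]
    have hs : |Real.sin (-(t * Real.exp (α * u) * Real.sin (α * (π/2))))| ≤
        t * Real.exp (α * u) := by
      refine (Real.abs_sin_le_abs).trans ?_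
      rw [abs_neg, abs_mul, abs_of_pos (by positivity)]
      exact mul_le_of_le_one_right (by positivity) (Real.abs_sin_le_one _)
    have he : Real.exp (((k:ℝ)+1) * u - x * Real.exp u
        - t * Real.exp (α * u) * Real.cos (α * (π/2))) ≤
        Real.exp (((k:ℝ)+1) * u - x * Real.exp u) := by
      apply Real.exp_le_exp.2
      have : 0 ≤ t * Real.exp (α * u) * Real.cos (α * (π/2)) := by positivity
      linarith
    refine (mul_le_mul he hs (abs_nonneg _) (Real.exp_pos _).le).trans (le_of_eq ?_)
    rw [← Real.exp_mul]
    rw [show Real.exp u * (t * (Real.exp (u * (α + 1 + k - 1)) * Real.exp (-(x * Real.exp u))))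
      = t * (Real.exp u * (Real.exp (u * (α + 1 + k - 1)) * Real.exp (-(x * Real.exp u)))) by ring,
      ← Real.exp_add, ← Real.exp_add, mul_left_comm, ← Real.exp_add]
    congr 2
    ring

theorem absint {α : ℝ} (hα : 0 < α) (n : ℕ) {t : ℝ} (ht : 0 < t) :
    Integrable (fun y : ℝ => |y| ^ n * Real.exp (-(t * |y| ^ α))) := by
  have hk : (0:ℝ) ≤ n := Nat.cast_nonneg n
  have hv := integral_rpow_mul_exp_neg_mul_rpow hα (q := n) (by linarith) ht
  have h2 := integral_comp_abs (f := fun y : ℝ => y ^ (n:ℝ) * Real.exp (-t * y ^ α))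
  rw [hv] at h2
  have hpos : 0 < 2 * (t ^ (-((n:ℝ) + 1) / α) * (1 / α) * Real.Gamma (((n:ℝ) + 1) / α)) := by
    have := Real.Gamma_pos_of_pos (s := ((n:ℝ) + 1) / α) (by positivity)
    positivity
  have h3 := Integrable.of_integral_ne_zero (by rw [h2]; exact hpos.ne')
  refine h3.congr (Eventually.of_forall fun y => ?_)
  simp only [Real.rpow_natCast, neg_mul]

theorem iteratedDeriv_re {f : ℝ → ℂ} {k : ℕ} (h : ContDiff ℝ k f) (x : ℝ) :
    iteratedDeriv k (fun y => (f y).re) x = (iteratedDeriv k f x).re := by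
  have := Complex.reCLM.iteratedFDeriv_comp_left (x := x) (i := k) h.contDiffAt le_rfl
  rw [iteratedDeriv_eq_iteratedFDeriv, iteratedDeriv_eq_iteratedFDeriv]
  have e : (fun y => (f y).re) = Complex.reCLM ∘ f := rfl
  rw [e, this]
  rfl

def Gf (α t : ℝ) (ξ : ℝ) : ℂ := Complex.exp ((-(t * |2 * π * ξ| ^ α) : ℝ) : ℂ)

theorem Gf_norm (α t ξ : ℝ) : ‖Gf α t ξ‖ = Real.exp (-(t * |2 * π * ξ| ^ α)) := by
  unfold Gf
  rw [Complex.norm_exp, Complex.ofReal_re]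

theorem Gf_cont {α : ℝ} (hα : 0 < α) (t : ℝ) : Continuous (Gf α t) := by
  unfold Gf
  have : Continuous fun ξ : ℝ => |2 * π * ξ| ^ α :=
    Continuous.rpow_const (by fun_prop) (fun _ => Or.inr hα.le)
  fun_prop

theorem Gf_int {α : ℝ} (hα : 0 < α) {t : ℝ} (ht : 0 < t) (n : ℕ) :
    Integrable (fun ξ : ℝ => ‖ξ‖ ^ n * ‖Gf α t ξ‖) := by
  have h := ((absint hα n ht).comp_mul_left' (R := 2 * π) (by positivity)).const_mul
    ((2 * π) ^ n)⁻¹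
  refine h.congr (Eventually.of_forall fun ξ => ?_)
  simp only
  rw [Gf_norm, Real.norm_eq_abs, abs_mul (2 * π), mul_pow, abs_of_pos (a := 2 * π) (by positivity)]
  field_simp
  ring

open FourierTransform in
theorem four_eq {α : ℝ} (hα : 0 < α) {t : ℝ} (ht : 0 < t) (k : ℕ) (x : ℝ) :
    ((𝓕 (fun ξ : ℝ ↦ (-2 * π * Complex.I * ξ) ^ k • Gf α t ξ)) x).re =
      (1 / π) * (Complex.I ^ k * Kfun α k t x).re := by
  rw [Real.fourier_real_eq_integral_exp_smul]
  set φ : ℝ → ℂ := fun y => (Complex.I * y) ^ k * Complex.exp (Complex.I * x * y - t * ((|y| ^ α : ℝ) : ℂ)) with hφ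
  have e1 : (∫ v : ℝ, Complex.exp (((-2 * π * v * x : ℝ) : ℂ) * Complex.I) •
      (-2 * π * Complex.I * v) ^ k • Gf α t v) = ∫ v : ℝ, φ ((-2 * π) * v) := by
    congr 1
    ext v
    simp only [hφ, Gf, smul_eq_mul]
    rw [mul_left_comm, ← Complex.exp_add]
    have : |-2 * π * v| = |2 * π * v| := by rw [← abs_neg]; congr 1; ring
    rw [this]
    congr 2
    · push_cast; ring
    · push_cast; ring
  have hφn : ∀ y, ‖φ y‖ = |y| ^ k * Real.exp (-(t * |y| ^ α)) := by
    intro y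
    simp only [hφ]
    rw [norm_mul, norm_pow, Complex.norm_exp, norm_mul, Complex.norm_I, one_mul, Complex.norm_real,
      Real.norm_eq_abs]
    congr 2
    simp
  have hφc : Continuous φ := by
    have : Continuous fun ξ : ℝ => |ξ| ^ α :=
      Continuous.rpow_const (by fun_prop) (fun _ => Or.inr hα.le)
    simp only [hφ]
    fun_prop
  have hφi : Integrable φ := by
    refine (absint hα k ht).mono' hφc.aestronglyMeasurable (Eventually.of_forall fun y => ?_)
    rw [hφn]
  have e2 : ∫ y in Ioi (0:ℝ), φ y = Complex.I ^ k * Kfun α k t x := by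
    unfold Kfun
    rw [← integral_const_mul]
    refine setIntegral_congr_fun measurableSet_Ioi fun z hz => ?_
    have hz : 0 < z := hz
    simp only [hφ, abs_of_pos hz]
    ring
  have e3 : ∫ y in Iic (0:ℝ), φ y = (starRingEnd ℂ) (∫ y in Ioi (0:ℝ), φ y) := by
    rw [← integral_conj]
    have := integral_comp_neg_Ioi 0 φ
    rw [neg_zero] at this
    rw [← this]
    congr 1
    ext y
    simp only [hφ, abs_neg, map_mul, map_pow, ← Complex.exp_conj, map_sub, Complex.conj_I,
      Complex.conj_ofReal]
    congr 2
    · push_cast; ring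
    · push_cast; ring
  rw [e1, Measure.integral_comp_mul_left, ← intervalIntegral.integral_Iic_add_Ioi (b := 0)
    hφi.integrableOn hφi.integrableOn, e3, e2, Complex.smul_re, Complex.add_re, Complex.conj_re]
  rw [abs_inv, show |(-2 * π)| = 2 * π by rw [← abs_neg, abs_of_pos] <;> [ring; (have := pi_pos; linarith)]]
  rw [smul_eq_mul]
  field_simp
  ring

theorem stableCF_zero (α t l : ℝ) : stableCF α 0 t l = Complex.exp ((-(t * |l| ^ α) : ℝ) : ℂ) := by
  unfold stableCF
  split_ifs with h
  · rw [h, Real.rpow_one]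
  · simp

open FourierTransform in
theorem density_eq {α : ℝ} (hα : 0 < α) {t : ℝ} (ht : 0 < t) {q : ℝ → ℝ} (hc : Continuous q)
    (hq : ∀ l : ℝ, (∫ x : ℝ, Complex.exp (Complex.I * (l : ℂ) * (x : ℂ)) * ((q x : ℝ) : ℂ))
        = stableCF α 0 t l) :
    (fun x => ((q x : ℝ) : ℂ)) = 𝓕 (Gf α t) := by
  have hi : Integrable (fun x => ((q x : ℝ) : ℂ)) := by
    apply Integrable.of_integral_ne_zero
    have := hq 0
    rw [stableCF_zero] at this
    simp only [Complex.ofReal_zero, mul_zero, zero_mul, Complex.exp_zero, one_mul] at this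
    rw [this]
    exact Complex.exp_ne_zero _
  have hF : 𝓕 (fun x => ((q x : ℝ) : ℂ)) = Gf α t := by
    ext ξ
    rw [Real.fourier_real_eq_integral_exp_smul]
    have := hq (-(2 * π * ξ))
    rw [stableCF_zero, abs_neg] at this
    rw [Gf, ← this]
    congr 1
    ext v
    rw [smul_eq_mul]
    congr 2
    push_cast
    ring
  have hcq : Continuous (fun x => ((q x : ℝ) : ℂ)) := by fun_prop
  have hGi : Integrable (Gf α t) := by
    have := Gf_int hα ht 0
    simp only [pow_zero, one_mul] at this
    exact (integrable_norm_iff (Gf_cont hα t).aestronglyMeasurable).1 this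
  have := hcq.fourierInv_fourier_eq hi (by rw [hF]; exact hGi)
  rw [← this, hF, Real.fourierInv_eq_fourier_comp_neg]
  congr 1
  ext ξ
  simp [Gf]

open FourierTransform in
theorem density_even {α : ℝ} {t : ℝ} {q : ℝ → ℝ}
    (h : (fun x => ((q x : ℝ) : ℂ)) = 𝓕 (Gf α t)) (x : ℝ) : q (-x) = q x := by
  have h1 : 𝓕⁻ (Gf α t) = 𝓕 (Gf α t) := by
    rw [Real.fourierInv_eq_fourier_comp_neg]
    congr 1
    ext ξ
    simp [Gf]
  have h2 := Real.fourierInv_eq_fourier_neg (Gf α t) x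
  rw [h1, ← h] at h2
  have h3 : ((q x : ℝ) : ℂ) = ((q (-x) : ℝ) : ℂ) := h2
  exact_mod_cast h3.symm

open FourierTransform in
theorem density_deriv {α : ℝ} (hα : 0 < α) {t : ℝ} (ht : 0 < t) {q : ℝ → ℝ}
    (h : (fun x => ((q x : ℝ) : ℂ)) = 𝓕 (Gf α t)) (k : ℕ) (x : ℝ) :
    iteratedDeriv k q x = (1 / π) * (Complex.I ^ k * Kfun α k t x).re := by
  rw [← four_eq hα ht]
  have hd : ContDiff ℝ k (𝓕 (Gf α t)) :=
    Real.contDiff_fourier (N := (k : ℕ∞)) (fun n _ => Gf_int hα ht n)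
  have h2 := iteratedDeriv_re hd x
  rw [Real.iteratedDeriv_fourier (N := (k:ℕ∞)) (fun n _ => ?_) le_rfl] at h2
  · rw [← h2, ← h]
    simp
  · have := Gf_int hα ht n
    have hm : AEStronglyMeasurable (fun ξ : ℝ => ξ ^ n • Gf α t ξ) := by
      have := Gf_cont hα t
      exact (by fun_prop : Continuous fun ξ : ℝ => ξ ^ n • Gf α t ξ).aestronglyMeasurable
    refine (integrable_norm_iff hm).1 (this.congr (Eventually.of_forall fun ξ => ?_))
    simp only [norm_smul, norm_pow]

/-- Lemma 2.1 (4): derivative estimates for symmetric stable densities. -/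
theorem stable_density_deriv_bound
    (α : ℝ) (hα0 : 0 < α) (hα1 : α ≤ 1)
    (p : ℝ → ℝ → ℝ)
    (hp : ∀ t : ℝ, 0 < t → (∀ x, 0 ≤ p t x) ∧ Continuous (p t) ∧
      ∀ l : ℝ, (∫ x : ℝ, Complex.exp (Complex.I * (l : ℂ) * (x : ℂ)) * ((p t x : ℝ) : ℂ))
        = stableCF α 0 t l) :
    ∀ k : ℕ, ∃ C > 0, ∀ t : ℝ, 0 < t → ∀ x : ℝ,
      |iteratedDeriv k (p t) x| ≤ C * t / (t ^ (1/α) + |x|) ^ (α + 1 + k) := by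
  intro k
  have hk : (0:ℝ) ≤ k := Nat.cast_nonneg k
  have hs : 0 < α + 1 + k := by positivity
  set A : ℝ := (1 / α) * Real.Gamma (((k:ℝ) + 1) / α) with hA
  have hApos : 0 < A := by
    have := Real.Gamma_pos_of_pos (s := ((k:ℝ) + 1) / α) (by positivity)
    positivity
  have hGpos : 0 < Real.Gamma (α + 1 + k) := Real.Gamma_pos_of_pos hs
  have h2pos : (0:ℝ) < 2 ^ (α + 1 + k) := by positivity
  refine ⟨1 / π * 2 ^ (α + 1 + k) * (A + Real.Gamma (α + 1 + k)), by positivity, ?_⟩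
  intro t ht
  obtain ⟨-, hc, hq⟩ := hp t ht
  have hD := density_eq hα0 ht hc hq
  have hev : (fun x => p t (-x)) = p t := funext fun x => density_even hD x
  -- reduce to nonnegative x
  suffices H : ∀ x : ℝ, 0 ≤ x → |iteratedDeriv k (p t) x| ≤
      1 / π * 2 ^ (α + 1 + k) * (A + Real.Gamma (α + 1 + k)) * t /
        (t ^ (1/α) + x) ^ (α + 1 + k) by
    intro x
    rcases le_total 0 x with hx | hx
    · have := H x hx
      rwa [abs_of_nonneg hx]
    · have := H (-x) (by linarith)
      rw [abs_of_nonpos hx]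
      have e := iteratedDeriv_comp_neg k (p t) x
      rw [hev] at e
      rw [e, smul_eq_mul, abs_mul, abs_pow, abs_neg, abs_one, one_pow, one_mul]
      exact this
  intro x hx
  have hT : 0 < t ^ (1/α) := by positivity
  rw [density_deriv hα0 ht hD, abs_mul, abs_of_pos (by positivity : (0:ℝ) < 1/π),
    le_div_iff₀ (by positivity)]
  rcases le_or_gt x (t ^ (1/α)) with hxt | hxt
  · have b1 : |(Complex.I ^ k * Kfun α k t x).re| ≤ t ^ (-((k:ℝ) + 1) / α) * A := by
      refine (Complex.abs_re_le_norm _).trans ?_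
      rw [norm_mul, norm_pow, Complex.norm_I, one_pow, one_mul, hA, ← mul_assoc]
      exact Kfun_norm_le hα0 k ht x
    have b2 : (t ^ (1/α) + x) ^ (α + 1 + k) ≤
        2 ^ (α + 1 + k) * (t ^ (1/α)) ^ (α + 1 + k) := by
      rw [← Real.mul_rpow (by norm_num) hT.le]
      exact Real.rpow_le_rpow (by positivity) (by linarith) hs.le
    have b3 : t ^ (-((k:ℝ) + 1) / α) * (t ^ (1/α)) ^ (α + 1 + k) = t := by
      rw [← Real.rpow_mul ht.le, ← Real.rpow_add ht]
      have : -((k:ℝ) + 1) / α + 1 / α * (α + 1 + k) = 1 := by field_simp; ring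
      rw [this, Real.rpow_one]
    calc 1 / π * |(Complex.I ^ k * Kfun α k t x).re| * (t ^ (1/α) + x) ^ (α + 1 + k)
        ≤ 1 / π * (t ^ (-((k:ℝ) + 1) / α) * A) *
          (2 ^ (α + 1 + k) * (t ^ (1/α)) ^ (α + 1 + k)) := by gcongr
      _ = 1 / π * 2 ^ (α + 1 + k) * A *
          (t ^ (-((k:ℝ) + 1) / α) * (t ^ (1/α)) ^ (α + 1 + k)) := by ring
      _ = 1 / π * 2 ^ (α + 1 + k) * A * t := by rw [b3]
      _ ≤ _ := by gcongr; linarith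
  · have hx0 : 0 < x := hT.trans hxt
    have b1 := Kfun_re_le hα0 hα1 k ht hx0
    have b2 : (t ^ (1/α) + x) ^ (α + 1 + k) ≤ 2 ^ (α + 1 + k) * x ^ (α + 1 + k) := by
      rw [← Real.mul_rpow (by norm_num) hx]
      exact Real.rpow_le_rpow (by positivity) (by linarith) hs.le
    have b3 : (1 / x) ^ (α + 1 + k) * x ^ (α + 1 + k) = 1 := by
      rw [← Real.mul_rpow (by positivity) hx, one_div_mul_cancel hx0.ne', Real.one_rpow]
    calc 1 / π * |(Complex.I ^ k * Kfun α k t x).re| * (t ^ (1/α) + x) ^ (α + 1 + k)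
        ≤ 1 / π * (t * ((1 / x) ^ (α + 1 + k) * Real.Gamma (α + 1 + k))) *
          (2 ^ (α + 1 + k) * x ^ (α + 1 + k)) := by gcongr
      _ = 1 / π * 2 ^ (α + 1 + k) * Real.Gamma (α + 1 + k) * t *
          ((1 / x) ^ (α + 1 + k) * x ^ (α + 1 + k)) := by ring
      _ = 1 / π * 2 ^ (α + 1 + k) * Real.Gamma (α + 1 + k) * t := by rw [b3, mul_one]
      _ ≤ _ := by gcongr; linarith
end
end
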